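/- arXiv:1306.2012 — 3 statements merged into one kernel-verified Lean document; each statement's English description precedes it below -/
import Mathlib

section
/- Let r ≥ 3 be fixed. There exist constants C > 0, δ > 0 and M_0 depending only on r such that for every degree sequence k with sum M ≥ M_0 divisible by r, k_max ≥ 2 and k_max^3 ≤ δM, one has Σ_{ℓ=0}^{N} |C_ℓ| = |C_0| · exp((r−1)M_2/(2M) + E) for some real E with |E| ≤ C·k_max^3/M. -/
open scoped Classical BigOperators

/-- The set of points for the configuration model: cell `i` contains `k i` points. -/
abbrev Pts {n : ℕ} (k : Fin n → ℕ) : Type := (i : Fin n) × Fin (k i)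

/-- `M`, the total degree. -/
def Mtot {n : ℕ} (k : Fin n → ℕ) : ℕ := ∑ i, k i

/-- `M₂ = Σ kᵢ(kᵢ−1)`. -/
def M2 {n : ℕ} (k : Fin n → ℕ) : ℕ := ∑ i, k i * (k i - 1)

/-- `M₃ = Σ kᵢ(kᵢ−1)(kᵢ−2)`. -/
def M3 {n : ℕ} (k : Fin n → ℕ) : ℕ := ∑ i, k i * (k i - 1) * (k i - 2)

/-- The maximum degree. -/
def kmax {n : ℕ} (k : Fin n → ℕ) : ℕ := Finset.univ.sup k

/-- `Q` is an unordered partition of the point set into parts of size `r`. -/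
def IsPartition {n : ℕ} (r : ℕ) (k : Fin n → ℕ) (Q : Finset (Finset (Pts k))) : Prop :=
  (∀ U ∈ Q, U.card = r) ∧ ∀ p : Pts k, ∃! U, U ∈ Q ∧ p ∈ U

/-- `Λ_r(k)`, the set of partitions of the points into parts of size `r`. -/
def Lam {n : ℕ} (r : ℕ) (k : Fin n → ℕ) : Set (Finset (Finset (Pts k))) :=
  {Q | IsPartition r k Q}

/-- `Λ_r(k)` as a finset. -/
noncomputable def LamFinset {n : ℕ} (r : ℕ) (k : Fin n → ℕ) :
    Finset (Finset (Finset (Pts k))) :=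
  Finset.univ.filter fun Q => IsPartition r k Q

/-- The set of vertices of the edge of `G(Q)` corresponding to a part `U`. -/
def vset {n : ℕ} {k : Fin n → ℕ} (U : Finset (Pts k)) : Finset (Fin n) :=
  U.image Sigma.fst

/-- Multiplicity of vertex `i` in the edge corresponding to a part `U`. -/
def mult {n : ℕ} {k : Fin n → ℕ} (U : Finset (Pts k)) (i : Fin n) : ℕ :=
  (U.filter fun p => p.1 = i).card

/-- `U` contains a loop: two distinct points lying in the same cell. -/
def HasLoop {n : ℕ} {k : Fin n → ℕ} (U : Finset (Pts k)) : Prop :=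
  ∃ x ∈ U, ∃ y ∈ U, x ≠ y ∧ x.1 = y.1

/-- The number of parts of `Q` which contain a loop. -/
noncomputable def nloops {n : ℕ} {k : Fin n → ℕ} (Q : Finset (Finset (Pts k))) : ℕ :=
  (Q.filter fun U => HasLoop U).card

/-- `N = max(⌈log M⌉, ⌈9(r−1)M₂/M⌉)`. -/
noncomputable def Nbound {n : ℕ} (r : ℕ) (k : Fin n → ℕ) : ℕ :=
  max ⌈Real.log (Mtot k)⌉₊ ⌈(9 * ((r : ℝ) - 1) * (M2 k : ℝ)) / (Mtot k : ℝ)⌉₊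

/-- `Λ_r⁺(k)`: partitions satisfying properties (i)–(iv). -/
noncomputable def LamPlus {n : ℕ} (r : ℕ) (k : Fin n → ℕ) :
    Set (Finset (Finset (Pts k))) :=
  {Q | IsPartition r k Q ∧
    (∀ U ∈ Q, ∀ i, mult U i ≤ 2) ∧
    (∀ U ∈ Q, ∀ i j, mult U i = 2 → mult U j = 2 → i = j) ∧
    (∀ U ∈ Q, ∀ W ∈ Q, U ≠ W → (vset U ∩ vset W).card ≤ 2) ∧
    nloops Q ≤ Nbound r k}

/-- `C_ℓ`: partitions in `Λ_r⁺(k)` with exactly `ℓ` parts containing a loop. -/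
noncomputable def Cset {n : ℕ} (r : ℕ) (k : Fin n → ℕ) (ℓ : ℕ) :
    Set (Finset (Finset (Pts k))) :=
  {Q ∈ LamPlus r k | nloops Q = ℓ}

/-- The result of an ℓ-switching replacing parts `U`, `W₁`, `W₂`. -/
def switchResult {n : ℕ} {k : Fin n → ℕ} (Q : Finset (Finset (Pts k)))
    (U W₁ W₂ : Finset (Pts k)) (x₁ x₂ y₁ y₂ : Pts k) : Finset (Finset (Pts k)) :=
  (Q \ {U, W₁, W₂}) ∪
    {(U \ {x₁, x₂}) ∪ {y₁, y₂}, (W₁ \ {y₁}) ∪ {x₁}, (W₂ \ {y₂}) ∪ {x₂}}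

/-- `(x₁,x₂,y₁,y₂)` specifies an ℓ-switching in `Q` with parts `U`, `W₁`, `W₂`. -/
def IsSwitching {n : ℕ} {k : Fin n → ℕ} (Q : Finset (Finset (Pts k)))
    (U W₁ W₂ : Finset (Pts k)) (x₁ x₂ y₁ y₂ : Pts k) : Prop :=
  U ∈ Q ∧ W₁ ∈ Q ∧ W₂ ∈ Q ∧ U ≠ W₁ ∧ U ≠ W₂ ∧ W₁ ≠ W₂ ∧
  x₁ ∈ U ∧ x₂ ∈ U ∧ x₁ ≠ x₂ ∧ x₁.1 = x₂.1 ∧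
  y₁ ∈ W₁ ∧ y₂ ∈ W₂ ∧ y₁.1 ≠ y₂.1

/-- The result of a reverse ℓ-switching replacing parts `Û`, `Ŵ₁`, `Ŵ₂`. -/
def revSwitchResult {n : ℕ} {k : Fin n → ℕ} (Q' : Finset (Finset (Pts k)))
    (Uh W₁h W₂h : Finset (Pts k)) (x₁ x₂ y₁ y₂ : Pts k) : Finset (Finset (Pts k)) :=
  (Q' \ {Uh, W₁h, W₂h}) ∪
    {(Uh \ {y₁, y₂}) ∪ {x₁, x₂}, (W₁h \ {x₁}) ∪ {y₁}, (W₂h \ {x₂}) ∪ {y₂}}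

/-- `(x₁,x₂,y₁,y₂)` specifies a reverse ℓ-switching in `Q'` with parts `Û`, `Ŵ₁`, `Ŵ₂`. -/
def IsRevSwitching {n : ℕ} {k : Fin n → ℕ} (Q' : Finset (Finset (Pts k)))
    (Uh W₁h W₂h : Finset (Pts k)) (x₁ x₂ y₁ y₂ : Pts k) : Prop :=
  Uh ∈ Q' ∧ W₁h ∈ Q' ∧ W₂h ∈ Q' ∧ Uh ≠ W₁h ∧ Uh ≠ W₂h ∧ W₁h ≠ W₂h ∧
  x₁ ∈ W₁h ∧ x₂ ∈ W₂h ∧ x₁.1 = x₂.1 ∧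
  y₁ ∈ Uh ∧ y₂ ∈ Uh ∧ y₁ ≠ y₂ ∧ y₁.1 ≠ y₂.1

/-- `Q` is simple: every edge of `G(Q)` consists of distinct vertices and all
edges are distinct. -/
def SimpleQ {n : ℕ} {k : Fin n → ℕ} (Q : Finset (Finset (Pts k))) : Prop :=
  (∀ U ∈ Q, (vset U).card = U.card) ∧
  ∀ U ∈ Q, ∀ W ∈ Q, U ≠ W → vset U ≠ vset W

/-- `|H_r(k)|`: the number of simple `r`-uniform hypergraphs on `{1,…,n}` with
degree sequence `k`, a hypergraph being recorded as its (distinct) edge set. -/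
noncomputable def Hcount (r : ℕ) {n : ℕ} (k : Fin n → ℕ) : ℕ :=
  Set.ncard {E : Finset (Finset (Fin n)) |
    (∀ e ∈ E, e.card = r) ∧ ∀ i, (E.filter fun e => i ∈ e).card = k i}


section Comb
variable {n : ℕ} {k : Fin n → ℕ}

/-- Action of a permutation of the points on families of sets of points. -/
def actQ (σ : Equiv.Perm (Pts k)) (Q : Finset (Finset (Pts k))) : Finset (Finset (Pts k)) :=
  Q.image (fun U => U.map σ.toEmbedding)

/-- The double swap. -/
def dswap (x₁ x₂ y₁ y₂ : Pts k) : Equiv.Perm (Pts k) := Equiv.swap x₁ y₁ * Equiv.swap x₂ y₂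

/-- The part of `Q` containing `p`. -/
noncomputable def part (Q : Finset (Finset (Pts k))) (p : Pts k) : Finset (Pts k) :=
  Finset.univ.filter fun q => ∃ U ∈ Q, p ∈ U ∧ q ∈ U

/-- Points in loop parts. -/
noncomputable def loopPts (Q : Finset (Finset (Pts k))) : Finset (Pts k) :=
  (Q.filter fun U => HasLoop U).biUnion id

/-- Points whose part is within distance two of `U`. -/
noncomputable def badPts (Q : Finset (Finset (Pts k))) (U : Finset (Pts k)) : Finset (Pts k) :=
  Finset.univ.filter fun p => ∃ A ∈ Q, ¬ Disjoint (vset A) (vset U) ∧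
    ¬ Disjoint (vset A) (vset (part Q p))

/-- Distance more than two. -/
def Far (Q : Finset (Finset (Pts k))) (U W : Finset (Pts k)) : Prop :=
  ∀ A ∈ Q, Disjoint (vset A) (vset U) ∨ Disjoint (vset A) (vset W)

lemma mem_vset {U : Finset (Pts k)} {i : Fin n} : i ∈ vset U ↔ ∃ p ∈ U, p.1 = i := by
  simp [vset, Finset.mem_image]

lemma fst_mem_vset {U : Finset (Pts k)} {p : Pts k} (h : p ∈ U) : p.1 ∈ vset U :=
  mem_vset.2 ⟨p, h, rfl⟩

lemma IsPartition.eq {r : ℕ} {Q : Finset (Finset (Pts k))} (hQ : IsPartition r k Q)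
    {U W : Finset (Pts k)} {p : Pts k} (hU : U ∈ Q) (hW : W ∈ Q) (h1 : p ∈ U) (h2 : p ∈ W) :
    U = W := (hQ.2 p).unique ⟨hU, h1⟩ ⟨hW, h2⟩

lemma part_eq {r : ℕ} {Q : Finset (Finset (Pts k))} (hQ : IsPartition r k Q)
    {U : Finset (Pts k)} {p : Pts k} (hU : U ∈ Q) (h1 : p ∈ U) : part Q p = U := by
  ext q
  simp only [part, Finset.mem_filter, Finset.mem_univ, true_and]
  constructor
  · rintro ⟨W, hW, hp, hq⟩
    rwa [hQ.eq hU hW h1 hp]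
  · intro hq
    exact ⟨U, hU, h1, hq⟩

lemma part_mem {r : ℕ} {Q : Finset (Finset (Pts k))} (hQ : IsPartition r k Q) (p : Pts k) :
    part Q p ∈ Q := by
  obtain ⟨U, ⟨hU, hp⟩, -⟩ := hQ.2 p
  rwa [part_eq hQ hU hp]

lemma mem_part {r : ℕ} {Q : Finset (Finset (Pts k))} (hQ : IsPartition r k Q) (p : Pts k) :
    p ∈ part Q p := by
  obtain ⟨U, ⟨hU, hp⟩, -⟩ := hQ.2 p
  rwa [part_eq hQ hU hp]

lemma mem_part_iff {Q : Finset (Finset (Pts k))} {p q : Pts k} :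
    q ∈ part Q p ↔ ∃ U ∈ Q, p ∈ U ∧ q ∈ U := by simp [part]

lemma actQ_partition {r : ℕ} {Q : Finset (Finset (Pts k))} (hQ : IsPartition r k Q)
    (σ : Equiv.Perm (Pts k)) : IsPartition r k (actQ σ Q) := by
  constructor
  · intro U hU
    obtain ⟨W, hW, rfl⟩ := Finset.mem_image.1 hU
    simpa using hQ.1 W hW
  · intro p
    obtain ⟨U, ⟨hU, hp⟩, -⟩ := hQ.2 (σ.symm p)
    refine ⟨U.map σ.toEmbedding, ⟨Finset.mem_image_of_mem _ hU, Finset.mem_map_equiv.2 hp⟩, ?_⟩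
    rintro W ⟨hW, hpW⟩
    obtain ⟨W, hW', rfl⟩ := Finset.mem_image.1 hW
    rw [hQ.eq hW' hU (Finset.mem_map_equiv.1 hpW) hp]

lemma mem_part_actQ {Q : Finset (Finset (Pts k))} (σ : Equiv.Perm (Pts k)) {p q : Pts k} :
    q ∈ part (actQ σ Q) p ↔ σ.symm q ∈ part Q (σ.symm p) := by
  simp only [mem_part_iff, actQ, Finset.mem_image, exists_exists_and_eq_and, Finset.mem_map_equiv]

lemma actQ_invol {Q : Finset (Finset (Pts k))} (σ : Equiv.Perm (Pts k)) (h : ∀ p, σ (σ p) = p) :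
    actQ σ (actQ σ Q) = Q := by
  have : (fun U : Finset (Pts k) => (U.map σ.toEmbedding).map σ.toEmbedding) = id := by
    funext U
    ext p
    have h' : σ.symm (σ.symm p) = p := by
      rw [Equiv.symm_apply_eq, Equiv.symm_apply_eq, h]
    simp only [Finset.mem_map_equiv, h', id]
  unfold actQ
  rw [Finset.image_image]
  show Finset.image (fun U : Finset (Pts k) => (U.map σ.toEmbedding).map σ.toEmbedding) Q = Q
  rw [this, Finset.image_id]

/-- distinctness of the four points -/
def Dist4 (x₁ x₂ y₁ y₂ : Pts k) : Prop :=
  x₁ ≠ x₂ ∧ y₁ ≠ y₂ ∧ x₁ ≠ y₁ ∧ x₁ ≠ y₂ ∧ x₂ ≠ y₁ ∧ x₂ ≠ y₂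

lemma dswap_apply {x₁ x₂ y₁ y₂ : Pts k} (h : Dist4 x₁ x₂ y₁ y₂) (p : Pts k) :
    dswap x₁ x₂ y₁ y₂ p = if p = x₁ then y₁ else if p = x₂ then y₂ else if p = y₁ then x₁
      else if p = y₂ then x₂ else p := by
  obtain ⟨h1, h2, h3, h4, h5, h6⟩ := h
  simp only [dswap, Equiv.Perm.mul_apply, Equiv.swap_apply_def]
  grind

lemma dswap_invol {x₁ x₂ y₁ y₂ : Pts k} (h : Dist4 x₁ x₂ y₁ y₂) (p : Pts k) :
    dswap x₁ x₂ y₁ y₂ (dswap x₁ x₂ y₁ y₂ p) = p := by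
  rw [dswap_apply h, dswap_apply h]
  obtain ⟨h1, h2, h3, h4, h5, h6⟩ := h
  grind

lemma dswap_symm {x₁ x₂ y₁ y₂ : Pts k} (h : Dist4 x₁ x₂ y₁ y₂) :
    (dswap x₁ x₂ y₁ y₂).symm = dswap x₁ x₂ y₁ y₂ := by
  ext1 p
  rw [Equiv.symm_apply_eq, dswap_invol h]

lemma dswap_comm {x₁ x₂ y₁ y₂ : Pts k} (h : Dist4 x₁ x₂ y₁ y₂) :
    dswap x₁ x₂ y₁ y₂ = dswap y₁ y₂ x₁ x₂ := by
  ext1 p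
  rw [dswap_apply h, dswap_apply]
  · obtain ⟨h1, h2, h3, h4, h5, h6⟩ := h
    grind
  · obtain ⟨h1, h2, h3, h4, h5, h6⟩ := h
    exact ⟨h2, h1, h3.symm, h5.symm, h4.symm, h6.symm⟩

/-- At most one loop. -/
def OneLoop (A : Finset (Pts k)) : Prop :=
  (∀ i, mult A i ≤ 2) ∧ (∀ i j, mult A i = 2 → mult A j = 2 → i = j)

lemma oneLoop_of {A : Finset (Pts k)} (x₁ x₂ : Pts k) (hx : x₁.1 = x₂.1)
    (h : ∀ p ∈ A, ∀ q ∈ A, p ≠ q → p.1 = q.1 → p = x₁ ∨ p = x₂) : OneLoop A := by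
  have key : ∀ i, 2 ≤ mult A i → mult A i ≤ 2 ∧ i = x₁.1 := by
    intro i hi
    have hsub : (A.filter fun p => p.1 = i) ⊆ {x₁, x₂} := by
      intro p hp
      obtain ⟨q, hq, hne⟩ := Finset.exists_mem_ne (lt_of_lt_of_le one_lt_two hi) p
      simp only [Finset.mem_filter] at hp hq
      simpa using h p hp.1 q hq.1 hne.symm (hp.2.trans hq.2.symm)
    refine ⟨(Finset.card_le_card hsub).trans Finset.card_le_two, ?_⟩
    obtain ⟨p, hp⟩ := Finset.card_pos.1 (lt_of_lt_of_le two_pos hi)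
    have h1 := hsub hp
    simp only [Finset.mem_filter, Finset.mem_insert, Finset.mem_singleton] at hp h1
    rcases h1 with h1 | h1
    · rw [← hp.2, h1]
    · rw [← hp.2, h1, hx]
  refine ⟨fun i => ?_, fun i j hi hj => ?_⟩
  · by_contra hc
    exact hc (key i (by omega)).1
  · rw [(key i hi.ge).2, (key j hj.ge).2]

lemma oneLoop_of_not {A : Finset (Pts k)} (h : ¬ HasLoop A) : OneLoop A := by
  by_cases hA : A.Nonempty
  · obtain ⟨x, hx⟩ := hA
    exact oneLoop_of x x rfl fun p hp q hq hne he => (h ⟨p, hp, q, hq, hne, he⟩).elim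
  · rw [Finset.not_nonempty_iff_eq_empty] at hA
    subst hA
    constructor
    · intro i; simp [mult]
    · intro i j hi; simp [mult] at hi

lemma OneLoop.eq {A : Finset (Pts k)} (h : OneLoop A) {x₁ x₂ p q : Pts k} (h1 : x₁ ∈ A)
    (h2 : x₂ ∈ A) (hne : x₁ ≠ x₂) (he : x₁.1 = x₂.1) (hp : p ∈ A) (hq : q ∈ A) (hpq : p ≠ q)
    (hpq' : p.1 = q.1) : p = x₁ ∨ p = x₂ := by
  have two : ∀ a b : Pts k, a ∈ A → b ∈ A → a ≠ b → a.1 = b.1 →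
      (A.filter fun p => p.1 = a.1) = {a, b} := by
    intro a b ha hb hab hab'
    symm
    apply Finset.eq_of_subset_of_card_le
    · intro c hc
      simp only [Finset.mem_insert, Finset.mem_singleton] at hc
      rcases hc with rfl | rfl
      · simp [ha]
      · simp [hb, hab']
    · rw [Finset.card_pair hab]; exact h.1 a.1
  have e1 := two x₁ x₂ h1 h2 hne he
  have e2 := two p q hp hq hpq hpq'
  have m1 : mult A x₁.1 = 2 := by unfold mult; rw [e1, Finset.card_pair hne]
  have m2 : mult A p.1 = 2 := by unfold mult; rw [e2, Finset.card_pair hpq]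
  have := h.2 _ _ m1 m2
  have hm : p ∈ (A.filter fun p => p.1 = x₁.1) := by simp [hp, this]
  rw [e1] at hm
  simpa using hm

lemma cset_iff {r ℓ : ℕ} {Q : Finset (Finset (Pts k))} : Q ∈ Cset r k ℓ ↔
    IsPartition r k Q ∧ (∀ U ∈ Q, OneLoop U) ∧
      (∀ U ∈ Q, ∀ W ∈ Q, U ≠ W → (vset U ∩ vset W).card ≤ 2) ∧ nloops Q = ℓ ∧ ℓ ≤ Nbound r k := by
  simp only [Cset, LamPlus, OneLoop, Set.mem_ofPred_eq]
  constructor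
  · rintro ⟨⟨h1, h2, h3, h4, h5⟩, h6⟩
    exact ⟨h1, fun U hU => ⟨h2 U hU, h3 U hU⟩, h4, h6, h6 ▸ h5⟩
  · rintro ⟨h1, h2, h4, h6, h5⟩
    exact ⟨⟨h1, fun U hU => (h2 U hU).1, fun U hU => (h2 U hU).2, h4, h6 ▸ h5⟩, h6⟩

end Comb


section Comb2
variable {n : ℕ} {k : Fin n → ℕ}

/-- A switching configuration. -/
structure Sw (r : ℕ) (Q : Finset (Finset (Pts k))) (U W₁ W₂ : Finset (Pts k))
    (a₁ a₂ b₁ b₂ : Pts k) : Prop where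
  hQ : IsPartition r k Q
  hU : U ∈ Q
  hW₁ : W₁ ∈ Q
  hW₂ : W₂ ∈ Q
  ha₁ : a₁ ∈ U
  ha₂ : a₂ ∈ U
  ha : a₁ ≠ a₂
  hb₁ : b₁ ∈ W₁
  hb₂ : b₂ ∈ W₂
  hW : W₁ ≠ W₂
  f₁ : Far Q U W₁
  f₂ : Far Q U W₂

lemma Far.disj {Q : Finset (Finset (Pts k))} {U W : Finset (Pts k)} (h : Far Q U W) (hU : U ∈ Q)
    : Disjoint (vset U) (vset W) := by
  rcases h U hU with h | h
  · rw [disjoint_self] at h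
    rw [h]; exact Finset.disjoint_empty_left _
  · exact h

namespace Sw
variable {r : ℕ} {Q : Finset (Finset (Pts k))} {U W₁ W₂ : Finset (Pts k)} {a₁ a₂ b₁ b₂ : Pts k}

lemma symm (s : Sw r Q U W₁ W₂ a₁ a₂ b₁ b₂) : Sw r Q U W₂ W₁ a₂ a₁ b₂ b₁ :=
  ⟨s.hQ, s.hU, s.hW₂, s.hW₁, s.ha₂, s.ha₁, s.ha.symm, s.hb₂, s.hb₁, s.hW.symm, s.f₂, s.f₁⟩

lemma not_mem (s : Sw r Q U W₁ W₂ a₁ a₂ b₁ b₂) {v : Fin n} (h : v ∈ vset U) : v ∉ vset W₁ :=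
  Finset.disjoint_left.1 (s.f₁.disj s.hU) h

lemma ne₁ (s : Sw r Q U W₁ W₂ a₁ a₂ b₁ b₂) : U ≠ W₁ := by
  rintro rfl
  exact s.not_mem (fst_mem_vset s.ha₁) (fst_mem_vset s.ha₁)

lemma dist (s : Sw r Q U W₁ W₂ a₁ a₂ b₁ b₂) : Dist4 a₁ a₂ b₁ b₂ := by
  refine ⟨s.ha, ?_, ?_, ?_, ?_, ?_⟩
  · intro h; exact s.hW (s.hQ.eq s.hW₁ s.hW₂ s.hb₁ (h ▸ s.hb₂))
  · intro h; exact s.ne₁ (s.hQ.eq s.hU s.hW₁ s.ha₁ (h ▸ s.hb₁))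
  · intro h; exact s.symm.ne₁ (s.hQ.eq s.hU s.hW₂ s.ha₁ (h ▸ s.hb₂))
  · intro h; exact s.ne₁ (s.hQ.eq s.hU s.hW₁ s.ha₂ (h ▸ s.hb₁))
  · intro h; exact s.symm.ne₁ (s.hQ.eq s.hU s.hW₂ s.ha₂ (h ▸ s.hb₂))

lemma dswap_eq (s : Sw r Q U W₁ W₂ a₁ a₂ b₁ b₂) : dswap a₂ a₁ b₂ b₁ = dswap a₁ a₂ b₁ b₂ := by
  ext1 p
  rw [dswap_apply s.dist, dswap_apply s.symm.dist]
  obtain ⟨h1, h2, h3, h4, h5, h6⟩ := s.dist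
  grind

lemma mem_map (s : Sw r Q U W₁ W₂ a₁ a₂ b₁ b₂) {A : Finset (Pts k)} {p : Pts k} :
    p ∈ A.map (dswap a₁ a₂ b₁ b₂).toEmbedding ↔ dswap a₁ a₂ b₁ b₂ p ∈ A := by
  rw [Finset.mem_map_equiv, dswap_symm s.dist]

lemma notMem (s : Sw r Q U W₁ W₂ a₁ a₂ b₁ b₂) {A B : Finset (Pts k)} {p : Pts k} (hA : A ∈ Q)
    (hB : B ∈ Q) (h : A ≠ B) (hp : p ∈ A) : p ∉ B :=
  fun h' => h (s.hQ.eq hA hB hp h')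

lemma mem_mapU (s : Sw r Q U W₁ W₂ a₁ a₂ b₁ b₂) {p : Pts k} :
    p ∈ U.map (dswap a₁ a₂ b₁ b₂).toEmbedding ↔ p = b₁ ∨ p = b₂ ∨ (p ∈ U ∧ p ≠ a₁ ∧ p ≠ a₂) := by
  rw [s.mem_map, dswap_apply s.dist]
  have h1 := s.notMem s.hW₁ s.hU s.ne₁.symm s.hb₁
  have h2 := s.notMem s.hW₂ s.hU s.symm.ne₁.symm s.hb₂
  have h3 := s.ha₁
  have h4 := s.ha₂
  obtain ⟨g1, g2, g3, g4, g5, g6⟩ := s.dist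
  grind

lemma mem_mapW (s : Sw r Q U W₁ W₂ a₁ a₂ b₁ b₂) {p : Pts k} :
    p ∈ W₁.map (dswap a₁ a₂ b₁ b₂).toEmbedding ↔ p = a₁ ∨ (p ∈ W₁ ∧ p ≠ b₁) := by
  rw [s.mem_map, dswap_apply s.dist]
  have h1 := s.notMem s.hU s.hW₁ s.ne₁ s.ha₁
  have h2 := s.notMem s.hU s.hW₁ s.ne₁ s.ha₂
  have h3 := s.notMem s.hW₂ s.hW₁ s.hW.symm s.hb₂
  have h4 := s.hb₁
  obtain ⟨g1, g2, g3, g4, g5, g6⟩ := s.dist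
  grind

lemma map_other (s : Sw r Q U W₁ W₂ a₁ a₂ b₁ b₂) {A : Finset (Pts k)} (hA : A ∈ Q) (h1 : A ≠ U)
    (h2 : A ≠ W₁) (h3 : A ≠ W₂) : A.map (dswap a₁ a₂ b₁ b₂).toEmbedding = A := by
  ext p
  rw [s.mem_map, dswap_apply s.dist]
  have h1' := s.notMem s.hU hA h1.symm s.ha₁
  have h2' := s.notMem s.hU hA h1.symm s.ha₂
  have h3' := s.notMem s.hW₁ hA h2.symm s.hb₁
  have h4' := s.notMem s.hW₂ hA h3.symm s.hb₂
  grind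

lemma vsetU (s : Sw r Q U W₁ W₂ a₁ a₂ b₁ b₂) {v : Fin n}
    (h : v ∈ vset (U.map (dswap a₁ a₂ b₁ b₂).toEmbedding)) :
    v = b₁.1 ∨ v = b₂.1 ∨ v ∈ vset U := by
  obtain ⟨p, hp, rfl⟩ := mem_vset.1 h
  rcases s.mem_mapU.1 hp with rfl | rfl | h
  · exact Or.inl rfl
  · exact Or.inr (Or.inl rfl)
  · exact Or.inr (Or.inr (fst_mem_vset h.1))

lemma vsetW (s : Sw r Q U W₁ W₂ a₁ a₂ b₁ b₂) {v : Fin n}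
    (h : v ∈ vset (W₁.map (dswap a₁ a₂ b₁ b₂).toEmbedding)) :
    v = a₁.1 ∨ v ∈ vset W₁ := by
  obtain ⟨p, hp, rfl⟩ := mem_vset.1 h
  rcases s.mem_mapW.1 hp with rfl | h
  · exact Or.inl rfl
  · exact Or.inr (fst_mem_vset h.1)

lemma vsetW₂ (s : Sw r Q U W₁ W₂ a₁ a₂ b₁ b₂) {v : Fin n}
    (h : v ∈ vset (W₂.map (dswap a₁ a₂ b₁ b₂).toEmbedding)) :
    v = a₂.1 ∨ v ∈ vset W₂ := by
  rw [← s.dswap_eq] at h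
  exact s.symm.vsetW h

lemma card_of_pair {S : Finset (Fin n)} (x y : Fin n) (h : ∀ v ∈ S, v = x ∨ v = y) : S.card ≤ 2 := by
  have : S ⊆ {x, y} := by
    intro v hv; simpa using h v hv
  exact (Finset.card_le_card this).trans Finset.card_le_two

lemma UA (s : Sw r Q U W₁ W₂ a₁ a₂ b₁ b₂) {A : Finset (Pts k)} (hA : A ∈ Q)
    (h : (vset U ∩ vset A).card ≤ 2) :
    (vset (U.map (dswap a₁ a₂ b₁ b₂).toEmbedding) ∩ vset A).card ≤ 2 := by
  by_cases hb : b₁.1 ∈ vset A ∨ b₂.1 ∈ vset A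
  · have hd : Disjoint (vset A) (vset U) := by
      rcases hb with hb | hb
      · rcases s.f₁ A hA with h | h
        · exact h
        · exact (Finset.disjoint_left.1 h hb (fst_mem_vset s.hb₁)).elim
      · rcases s.f₂ A hA with h | h
        · exact h
        · exact (Finset.disjoint_left.1 h hb (fst_mem_vset s.hb₂)).elim
    apply card_of_pair b₁.1 b₂.1
    intro v hv
    rw [Finset.mem_inter] at hv
    rcases s.vsetU hv.1 with h | h | h
    · exact Or.inl h
    · exact Or.inr h
    · exact (Finset.disjoint_left.1 hd hv.2 h).elim
  · push Not at hb
    refine (Finset.card_le_card ?_).trans h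
    intro v hv
    rw [Finset.mem_inter] at hv ⊢
    rcases s.vsetU hv.1 with h | h | h
    · exact (hb.1 (h ▸ hv.2)).elim
    · exact (hb.2 (h ▸ hv.2)).elim
    · exact ⟨h, hv.2⟩

lemma WA (s : Sw r Q U W₁ W₂ a₁ a₂ b₁ b₂) {A : Finset (Pts k)} (hA : A ∈ Q)
    (h : (vset W₁ ∩ vset A).card ≤ 2) :
    (vset (W₁.map (dswap a₁ a₂ b₁ b₂).toEmbedding) ∩ vset A).card ≤ 2 := by
  by_cases hb : a₁.1 ∈ vset A
  · have hd : Disjoint (vset A) (vset W₁) := by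
      rcases s.f₁ A hA with h | h
      · exact (Finset.disjoint_left.1 h hb (fst_mem_vset s.ha₁)).elim
      · exact h
    apply card_of_pair a₁.1 a₁.1
    intro v hv
    rw [Finset.mem_inter] at hv
    rcases s.vsetW hv.1 with h | h
    · exact Or.inl h
    · exact (Finset.disjoint_left.1 hd hv.2 h).elim
  · refine (Finset.card_le_card ?_).trans h
    intro v hv
    rw [Finset.mem_inter] at hv ⊢
    rcases s.vsetW hv.1 with h | h
    · exact (hb (h ▸ hv.2)).elim
    · exact ⟨h, hv.2⟩

lemma UW (s : Sw r Q U W₁ W₂ a₁ a₂ b₁ b₂) (h : b₂.1 = b₁.1 ∨ Disjoint (vset W₁) (vset W₂)) :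
    (vset (U.map (dswap a₁ a₂ b₁ b₂).toEmbedding) ∩
      vset (W₁.map (dswap a₁ a₂ b₁ b₂).toEmbedding)).card ≤ 2 := by
  apply card_of_pair a₁.1 b₁.1
  intro v hv
  rw [Finset.mem_inter] at hv
  rcases s.vsetW hv.2 with h1 | h1
  · exact Or.inl h1
  · rcases s.vsetU hv.1 with h2 | h2 | h2
    · exact Or.inr h2
    · rcases h with h | h
      · exact Or.inr (h2.trans h)
      · exact (Finset.disjoint_left.1 h h1 (h2 ▸ fst_mem_vset s.hb₂)).elim
    · exact (s.not_mem h2 h1).elim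

lemma WW (s : Sw r Q U W₁ W₂ a₁ a₂ b₁ b₂) (h0 : (vset W₁ ∩ vset W₂).card ≤ 2)
    (h : a₁.1 ≠ a₂.1 ∨ Disjoint (vset W₁) (vset W₂)) :
    (vset (W₁.map (dswap a₁ a₂ b₁ b₂).toEmbedding) ∩
      vset (W₂.map (dswap a₁ a₂ b₁ b₂).toEmbedding)).card ≤ 2 := by
  have n1 := s.not_mem (fst_mem_vset s.ha₂)
  have n2 := s.symm.not_mem (fst_mem_vset s.ha₁)
  rcases h with h | h
  · refine (Finset.card_le_card ?_).trans h0
    intro v hv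
    rw [Finset.mem_inter] at hv ⊢
    have e1 := s.vsetW hv.1
    have e2 := s.vsetW₂ hv.2
    grind
  · apply card_of_pair a₁.1 a₂.1
    intro v hv
    rw [Finset.mem_inter] at hv
    have e1 := s.vsetW hv.1
    have e2 := s.vsetW₂ hv.2
    have : v ∈ vset W₁ → v ∉ vset W₂ := fun hv1 => Finset.disjoint_left.1 h hv1
    tauto

/-- Condition (iii) is preserved. -/
lemma iii (s : Sw r Q U W₁ W₂ a₁ a₂ b₁ b₂)
    (h3 : ∀ U ∈ Q, ∀ W ∈ Q, U ≠ W → (vset U ∩ vset W).card ≤ 2)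
    (h : (a₁.1 ≠ a₂.1 ∧ b₁.1 = b₂.1) ∨ Disjoint (vset W₁) (vset W₂)) :
    ∀ A ∈ Q, ∀ B ∈ Q, A ≠ B → (vset (A.map (dswap a₁ a₂ b₁ b₂).toEmbedding) ∩
      vset (B.map (dswap a₁ a₂ b₁ b₂).toEmbedding)).card ≤ 2 := by
  have uw1 := s.UW (by tauto)
  have uw2 := s.symm.UW (by rw [disjoint_comm]; tauto)
  rw [s.dswap_eq] at uw2
  have ww := s.WW (h3 _ s.hW₁ _ s.hW₂ s.hW) (by tauto)
  have ua : ∀ A ∈ Q, A ≠ U → A ≠ W₁ → A ≠ W₂ →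
    (vset (U.map (dswap a₁ a₂ b₁ b₂).toEmbedding) ∩
      vset (A.map (dswap a₁ a₂ b₁ b₂).toEmbedding)).card ≤ 2 := by
    intro A hA h1 h2 h4
    rw [s.map_other hA h1 h2 h4]
    exact s.UA hA (h3 _ s.hU _ hA h1.symm)
  have wa1 : ∀ A ∈ Q, A ≠ U → A ≠ W₁ → A ≠ W₂ →
    (vset (W₁.map (dswap a₁ a₂ b₁ b₂).toEmbedding) ∩
      vset (A.map (dswap a₁ a₂ b₁ b₂).toEmbedding)).card ≤ 2 := by
    intro A hA h1 h2 h4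
    rw [s.map_other hA h1 h2 h4]
    exact s.WA hA (h3 _ s.hW₁ _ hA h2.symm)
  have wa2 : ∀ A ∈ Q, A ≠ U → A ≠ W₁ → A ≠ W₂ →
    (vset (W₂.map (dswap a₁ a₂ b₁ b₂).toEmbedding) ∩
      vset (A.map (dswap a₁ a₂ b₁ b₂).toEmbedding)).card ≤ 2 := by
    intro A hA h1 h2 h4
    rw [s.map_other hA h1 h2 h4, ← s.dswap_eq]
    exact s.symm.WA hA (h3 _ s.hW₂ _ hA h4.symm)
  have aa : ∀ A ∈ Q, A ≠ U → A ≠ W₁ → A ≠ W₂ → ∀ B ∈ Q, B ≠ U → B ≠ W₁ → B ≠ W₂ → A ≠ B →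
    (vset (A.map (dswap a₁ a₂ b₁ b₂).toEmbedding) ∩
      vset (B.map (dswap a₁ a₂ b₁ b₂).toEmbedding)).card ≤ 2 := by
    intro A hA h1 h2 h4 B hB g1 g2 g4 hAB
    rw [s.map_other hA h1 h2 h4, s.map_other hB g1 g2 g4]
    exact h3 _ hA _ hB hAB
  have sy : ∀ A B : Finset (Pts k), (vset (A.map (dswap a₁ a₂ b₁ b₂).toEmbedding) ∩
      vset (B.map (dswap a₁ a₂ b₁ b₂).toEmbedding)).card =
      (vset (B.map (dswap a₁ a₂ b₁ b₂).toEmbedding) ∩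
      vset (A.map (dswap a₁ a₂ b₁ b₂).toEmbedding)).card := by
    intro A B; rw [Finset.inter_comm]
  intro A hA B hB hAB
  by_cases A1 : A = U
  · subst A1
    by_cases B2 : B = W₁
    · subst B2; exact uw1
    by_cases B3 : B = W₂
    · subst B3; exact uw2
    exact ua B hB hAB.symm B2 B3
  by_cases A2 : A = W₁
  · subst A2
    by_cases B1 : B = U
    · subst B1; rw [sy]; exact uw1
    by_cases B3 : B = W₂
    · subst B3; exact ww
    exact wa1 B hB B1 hAB.symm B3
  by_cases A3 : A = W₂
  · subst A3
    by_cases B1 : B = U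
    · subst B1; rw [sy]; exact uw2
    by_cases B2 : B = W₁
    · subst B2; rw [sy]; exact ww
    exact wa2 B hB B1 B2 hAB.symm
  by_cases B1 : B = U
  · subst B1; rw [sy]; exact ua A hA A1 A2 A3
  by_cases B2 : B = W₁
  · subst B2; rw [sy]; exact wa1 A hA A1 A2 A3
  by_cases B3 : B = W₂
  · subst B3; rw [sy]; exact wa2 A hA A1 A2 A3
  exact aa A hA A1 A2 A3 B hB B1 B2 B3 hAB

lemma noloopW (s : Sw r Q U W₁ W₂ a₁ a₂ b₁ b₂) (h : ¬ HasLoop W₁) :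
    ¬ HasLoop (W₁.map (dswap a₁ a₂ b₁ b₂).toEmbedding) := by
  rintro ⟨x, hx, y, hy, hne, he⟩
  have n1 := s.not_mem (fst_mem_vset s.ha₁)
  rcases s.mem_mapW.1 hx with hx' | hx' <;> rcases s.mem_mapW.1 hy with hy' | hy'
  · exact hne (hx'.trans hy'.symm)
  · exact n1 (hx' ▸ he ▸ fst_mem_vset hy'.1)
  · exact n1 (hy' ▸ he ▸ fst_mem_vset hx'.1)
  · exact h ⟨x, hx'.1, y, hy'.1, hne, he⟩

/-- Membership of the switched partition. -/
lemma mem_cset (s : Sw r Q U W₁ W₂ a₁ a₂ b₁ b₂) {ℓ ℓ' : ℕ} (hQ : Q ∈ Cset r k ℓ)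
    (h : (a₁.1 ≠ a₂.1 ∧ b₁.1 = b₂.1) ∨ Disjoint (vset W₁) (vset W₂))
    (l1 : ¬ HasLoop W₁) (l2 : ¬ HasLoop W₂)
    (hone : OneLoop (U.map (dswap a₁ a₂ b₁ b₂).toEmbedding))
    (hN : ℓ' ≤ Nbound r k)
    (hl : (HasLoop U ∧ ¬ HasLoop (U.map (dswap a₁ a₂ b₁ b₂).toEmbedding) ∧ ℓ = ℓ' + 1) ∨
      (¬ HasLoop U ∧ HasLoop (U.map (dswap a₁ a₂ b₁ b₂).toEmbedding) ∧ ℓ' = ℓ + 1)) :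
    actQ (dswap a₁ a₂ b₁ b₂) Q ∈ Cset r k ℓ' := by
  rw [cset_iff] at hQ ⊢
  obtain ⟨h1, h2, h3, h4, h5⟩ := hQ
  have l1' := s.noloopW l1
  have l2' := s.symm.noloopW l2
  rw [s.dswap_eq] at l2'
  have hloop : ∀ A ∈ Q, A ≠ U →
      (HasLoop (A.map (dswap a₁ a₂ b₁ b₂).toEmbedding) ↔ HasLoop A) := by
    intro A hA hAU
    by_cases A1 : A = W₁
    · subst A1; tauto
    by_cases A2 : A = W₂
    · subst A2; tauto
    rw [s.map_other hA hAU A1 A2]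
  refine ⟨actQ_partition h1 _, ?_, ?_, ?_, hN⟩
  · intro B hB
    obtain ⟨A, hA, rfl⟩ := Finset.mem_image.1 hB
    by_cases A0 : A = U
    · subst A0; exact hone
    by_cases A1 : A = W₁
    · subst A1; exact oneLoop_of_not l1'
    by_cases A2 : A = W₂
    · subst A2; exact oneLoop_of_not l2'
    rw [s.map_other hA A0 A1 A2]
    exact h2 A hA
  · intro A' hA B' hB hAB
    obtain ⟨A, hA', rfl⟩ := Finset.mem_image.1 hA
    obtain ⟨B, hB', rfl⟩ := Finset.mem_image.1 hB
    exact s.iii h3 h A hA' B hB' (by rintro rfl; exact hAB rfl)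
  · have e : nloops (actQ (dswap a₁ a₂ b₁ b₂) Q) =
        (Q.filter fun A => HasLoop (A.map (dswap a₁ a₂ b₁ b₂).toEmbedding)).card := by
      unfold nloops actQ
      rw [Finset.filter_image, Finset.card_image_of_injective]
      exact Finset.map_injective _
    rw [e]
    unfold nloops at h4
    rcases hl with ⟨g1, g2, g3⟩ | ⟨g1, g2, g3⟩
    · have : (Q.filter fun A => HasLoop (A.map (dswap a₁ a₂ b₁ b₂).toEmbedding)) =
          (Q.filter fun A => HasLoop A).erase U := by
        ext A
        simp only [Finset.mem_filter, Finset.mem_erase]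
        by_cases hA : A = U
        · subst hA; tauto
        · have := hloop A
          tauto
      rw [this, Finset.card_erase_of_mem (by simp [g1, s.hU])]
      omega
    · have : (Q.filter fun A => HasLoop (A.map (dswap a₁ a₂ b₁ b₂).toEmbedding)) =
          insert U (Q.filter fun A => HasLoop A) := by
        ext A
        simp only [Finset.mem_filter, Finset.mem_insert]
        by_cases hA : A = U
        · subst hA
          have := s.hU
          tauto
        · have := hloop A
          tauto
      rw [this, Finset.card_insert_of_notMem (by simp [g1])]
      omega

end Sw

end Comb2


section Comb3
variable {n : ℕ} {k : Fin n → ℕ} {r : ℕ}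

lemma far_of_notMem_bad {Q : Finset (Finset (Pts k))} {U : Finset (Pts k)} {p : Pts k}
    (h : p ∉ badPts Q U) : Far Q U (part Q p) := by
  intro A hA
  by_contra hc
  push Not at hc
  exact h (by simp only [badPts, Finset.mem_filter, Finset.mem_univ, true_and]; exact ⟨A, hA, hc⟩)

lemma noloop_of_notMem {Q : Finset (Finset (Pts k))} (hQ : IsPartition r k Q) {p : Pts k}
    (h : p ∉ loopPts Q) : ¬ HasLoop (part Q p) := by
  intro hl
  exact h (by
    simp only [loopPts, Finset.mem_biUnion, Finset.mem_filter, id]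
    exact ⟨part Q p, ⟨part_mem hQ p, hl⟩, mem_part hQ p⟩)

lemma Far.ne {Q : Finset (Finset (Pts k))} {p q : Pts k} (hQ : IsPartition r k Q)
    (h : Far Q (part Q p) (part Q q)) : part Q p ≠ part Q q := by
  intro he
  have := h.disj (part_mem hQ p)
  rw [← he, disjoint_self] at this
  have h2 := fst_mem_vset (mem_part hQ p)
  rw [this] at h2
  simp at h2

/-- Forward switching. -/
lemma fwd {ℓ : ℕ} {Q : Finset (Finset (Pts k))} (hQ : Q ∈ Cset r k (ℓ + 1)) {x₁ x₂ y₁ y₂ : Pts k}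
    (hx : x₁ ≠ x₂) (hx' : x₁.1 = x₂.1) (hadj : x₂ ∈ part Q x₁) (l1 : y₁ ∉ loopPts Q)
    (l2 : y₂ ∉ loopPts Q) (b1 : y₁ ∉ badPts Q (part Q x₁)) (b2 : y₂ ∉ badPts Q (part Q x₁))
    (b3 : y₂ ∉ badPts Q (part Q y₁)) :
    actQ (dswap x₁ x₂ y₁ y₂) Q ∈ Cset r k ℓ ∧ Dist4 x₁ x₂ y₁ y₂ := by
  have hQ' := cset_iff.1 hQ
  obtain ⟨hP, h1, h3, h4, h5⟩ := hQ'
  have f3 := far_of_notMem_bad b3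
  have s : Sw r Q (part Q x₁) (part Q y₁) (part Q y₂) x₁ x₂ y₁ y₂ :=
    ⟨hP, part_mem hP _, part_mem hP _, part_mem hP _, mem_part hP _, hadj, hx, mem_part hP _,
      mem_part hP _, f3.ne hP, far_of_notMem_bad b1, far_of_notMem_bad b2⟩
  have hnl : ¬ HasLoop ((part Q x₁).map (dswap x₁ x₂ y₁ y₂).toEmbedding) := by
    rintro ⟨p, hp, q, hq, hne, he⟩
    have d12 := Finset.disjoint_left.1 (f3.disj (part_mem hP _)) (fst_mem_vset s.hb₁)
    have d1 : ∀ p ∈ part Q x₁, p.1 ≠ y₁.1 := fun p hp h =>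
      s.not_mem (fst_mem_vset hp) (h ▸ fst_mem_vset s.hb₁)
    have d2 : ∀ p ∈ part Q x₁, p.1 ≠ y₂.1 := fun p hp h =>
      s.symm.not_mem (fst_mem_vset hp) (h ▸ fst_mem_vset s.hb₂)
    have d3 : y₁.1 ≠ y₂.1 := fun h => d12 (h ▸ fst_mem_vset s.hb₂)
    have huniq := fun hp hq => (h1 _ (part_mem hP x₁)).eq (mem_part hP x₁) hadj hx hx'
      (p := p) (q := q) hp hq hne he
    have := s.mem_mapU.1 hp
    have := s.mem_mapU.1 hq
    grind
  refine ⟨s.mem_cset hQ (Or.inr (f3.disj (part_mem hP _))) (noloop_of_notMem hP l1)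
    (noloop_of_notMem hP l2) (oneLoop_of_not hnl) (by omega) (Or.inl ⟨?_, hnl, rfl⟩), s.dist⟩
  exact ⟨x₁, mem_part hP _, x₂, hadj, hx, hx'⟩

/-- Reverse switching. -/
lemma rev {ℓ : ℕ} {Q : Finset (Finset (Pts k))} (hQ : Q ∈ Cset r k ℓ) (hN : ℓ + 1 ≤ Nbound r k)
    {x₁ x₂ y₁ y₂ : Pts k}
    (hx : x₁ ≠ x₂) (hx' : x₁.1 = x₂.1) (l1 : x₁ ∉ loopPts Q) (l2 : x₂ ∉ loopPts Q)
    (hy : y₁ ≠ y₂) (hadj : y₂ ∈ part Q y₁) (l3 : y₁ ∉ loopPts Q)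
    (b1 : y₁ ∉ badPts Q (part Q x₁)) (b2 : y₁ ∉ badPts Q (part Q x₂)) :
    actQ (dswap x₁ x₂ y₁ y₂) Q ∈ Cset r k (ℓ + 1) ∧ Dist4 x₁ x₂ y₁ y₂ := by
  have hQ' := cset_iff.1 hQ
  obtain ⟨hP, h1, h3, h4, h5⟩ := hQ'
  have nl1 := noloop_of_notMem hP l1
  have nl2 := noloop_of_notMem hP l2
  have nl3 := noloop_of_notMem hP l3
  have hne : part Q x₁ ≠ part Q x₂ := by
    intro he
    exact nl1 ⟨x₁, mem_part hP _, x₂, he ▸ mem_part hP x₂, hx, hx'⟩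
  have f1 := far_of_notMem_bad b1
  have f2 := far_of_notMem_bad b2
  have s : Sw r Q (part Q y₁) (part Q x₁) (part Q x₂) y₁ y₂ x₁ x₂ :=
    ⟨hP, part_mem hP _, part_mem hP _, part_mem hP _, mem_part hP _, hadj, hy, mem_part hP _,
      mem_part hP _, hne, fun A hA => (f1 A hA).symm, fun A hA => (f2 A hA).symm⟩
  have hd := s.dist
  have hd' : Dist4 x₁ x₂ y₁ y₂ := by
    obtain ⟨h1, h2, h3, h4, h5, h6⟩ := hd
    exact ⟨h2, h1, h3.symm, h5.symm, h4.symm, h6.symm⟩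
  refine ⟨?_, hd'⟩
  rw [dswap_comm hd']
  have hv : y₁.1 ≠ y₂.1 := fun h => nl3 ⟨y₁, mem_part hP _, y₂, hadj, hy, h⟩
  refine s.mem_cset hQ (Or.inl ⟨hv, hx'⟩) nl1 nl2 ?_ hN (Or.inr ⟨nl3, ?_, rfl⟩)
  · apply oneLoop_of x₁ x₂ hx'
    intro p hp q hq hne he
    have d1 : ∀ p ∈ part Q y₁, p.1 ≠ x₁.1 := fun p hp h =>
      s.not_mem (fst_mem_vset hp) (h ▸ fst_mem_vset s.hb₁)
    have d2 : ∀ p ∈ part Q y₁, p.1 ≠ x₂.1 := fun p hp h =>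
      s.symm.not_mem (fst_mem_vset hp) (h ▸ fst_mem_vset s.hb₂)
    have d3 : p ∈ part Q y₁ → q ∉ part Q y₁ := fun hp hq => nl3 ⟨p, hp, q, hq, hne, he⟩
    have := s.mem_mapU.1 hp
    have := s.mem_mapU.1 hq
    grind
  · exact ⟨x₁, s.mem_mapU.2 (Or.inl rfl), x₂, s.mem_mapU.2 (Or.inr (Or.inl rfl)), hx, hx'⟩

lemma card_part {Q : Finset (Finset (Pts k))} (hP : IsPartition r k Q) (p : Pts k) :
    (part Q p).card = r := hP.1 _ (part_mem hP p)

/-- Points of a cell. -/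
noncomputable def cellPts (i : Fin n) : Finset (Pts k) := Finset.univ.filter fun p => p.1 = i

lemma card_cell (i : Fin n) : (cellPts i : Finset (Pts k)).card = k i := by
  have : (cellPts i : Finset (Pts k)) =
      (Finset.univ : Finset (Fin (k i))).map ⟨fun j => (⟨i, j⟩ : Pts k), fun a b h => by simpa using h⟩ := by
    ext ⟨a, b⟩
    simp only [cellPts, Finset.mem_filter, Finset.mem_univ, true_and, Finset.mem_map,
      Function.Embedding.coeFn_mk]
    constructor
    · rintro rfl; exact ⟨b, rfl⟩
    · rintro ⟨c, hc⟩; exact (congrArg Sigma.fst hc).symm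
  rw [this]; simp

lemma k_le (i : Fin n) : k i ≤ kmax k := Finset.le_sup (f := k) (Finset.mem_univ i)

lemma card_bad {Q : Finset (Finset (Pts k))} (hP : IsPartition r k Q) {U : Finset (Pts k)}
    (hU : U ∈ Q) : (badPts Q U).card ≤ r ^ 3 * kmax k ^ 2 := by
  have hsub : badPts Q U ⊆ ((((U.biUnion fun p => cellPts p.1).biUnion fun p => part Q p).biUnion
      fun p => cellPts p.1).biUnion fun p => part Q p) := by
    intro p hp
    simp only [badPts, Finset.mem_filter, Finset.mem_univ, true_and] at hp
    obtain ⟨A, hA, h1, h2⟩ := hp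
    rw [Finset.not_disjoint_iff] at h1 h2
    obtain ⟨i, hi, hi'⟩ := h1
    obtain ⟨j, hj, hj'⟩ := h2
    obtain ⟨a, ha, rfl⟩ := mem_vset.1 hi
    obtain ⟨u, hu, hu'⟩ := mem_vset.1 hi'
    obtain ⟨b, hb, rfl⟩ := mem_vset.1 hj
    obtain ⟨w, hw, hw'⟩ := mem_vset.1 hj'
    simp only [Finset.mem_biUnion]
    refine ⟨w, ⟨b, ⟨a, ⟨u, hu, ?_⟩, ?_⟩, ?_⟩, ?_⟩
    · simp [cellPts, hu']
    · rwa [part_eq hP hA ha]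
    · simp [cellPts, hw']
    · rw [part_eq hP (part_mem hP p) hw]; exact mem_part hP p
  refine (Finset.card_le_card hsub).trans ?_
  have c1 : ∀ p : Pts k, (cellPts p.1 : Finset (Pts k)).card ≤ kmax k := fun p => by
    rw [card_cell]; exact k_le _
  have c2 : ∀ p : Pts k, (part Q p).card ≤ r := fun p => (card_part hP p).le
  refine (Finset.card_biUnion_le_card_mul _ _ r fun p _ => c2 p).trans ?_
  have := (Finset.card_biUnion_le_card_mul U (fun p => (cellPts p.1 : Finset (Pts k))) _
    fun p _ => c1 p)
  have h2 := (Finset.card_biUnion_le_card_mul (U.biUnion fun p => (cellPts p.1 : Finset (Pts k)))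
    (fun p => part Q p) r fun p _ => c2 p)
  have h3 := (Finset.card_biUnion_le_card_mul ((U.biUnion fun p =>
    (cellPts p.1 : Finset (Pts k))).biUnion fun p => part Q p)
    (fun p => (cellPts p.1 : Finset (Pts k))) _ fun p _ => c1 p)
  rw [hP.1 U hU] at this
  calc _ ≤ (((r * kmax k) * r) * kmax k) * r := by
        gcongr
        refine h3.trans ?_
        gcongr
        refine h2.trans ?_
        gcongr
    _ = _ := by ring

lemma card_loopPts {ℓ : ℕ} {Q : Finset (Finset (Pts k))} (hP : IsPartition r k Q)
    (h : nloops Q = ℓ) : (loopPts Q).card ≤ ℓ * r := by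
  rw [← h]
  refine Finset.card_biUnion_le_card_mul _ _ r fun U hU => ?_
  exact (hP.1 U (Finset.mem_filter.1 hU).1).le

lemma card_pts : Fintype.card (Pts k) = Mtot k := by
  simp [Mtot]

/-- Ordered pairs of distinct points in the same cell. -/
noncomputable def cellPairs : Finset (Pts k × Pts k) :=
  Finset.univ.filter fun z => z.1 ≠ z.2 ∧ z.1.1 = z.2.1

/-- Ordered pairs of distinct points in the same part. -/
noncomputable def partPairs (Q : Finset (Finset (Pts k))) : Finset (Pts k × Pts k) :=
  Finset.univ.filter fun z => z.1 ≠ z.2 ∧ z.2 ∈ part Q z.1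

/-- Ordered loops. -/
noncomputable def loopPairs (Q : Finset (Finset (Pts k))) : Finset (Pts k × Pts k) :=
  Finset.univ.filter fun z => z.1 ≠ z.2 ∧ z.1.1 = z.2.1 ∧ z.2 ∈ part Q z.1

lemma card_filter_prod {α β : Type*} [Fintype α] [Fintype β] (p : α × β → Prop)
    [DecidablePred p] : (Finset.univ.filter p).card = ∑ a : α, (Finset.univ.filter fun b => p (a, b)).card := by
  simp only [Finset.card_filter]
  rw [Fintype.sum_prod_type]

lemma card_cellPairs : (cellPairs : Finset (Pts k × Pts k)).card = M2 k := by
  unfold cellPairs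
  rw [card_filter_prod]
  have : ∀ a : Pts k, (Finset.univ.filter fun b : Pts k => a ≠ b ∧ a.1 = b.1).card = k a.1 - 1 := by
    intro a
    have : (Finset.univ.filter fun b : Pts k => a ≠ b ∧ a.1 = b.1) = (cellPts a.1).erase a := by
      ext b
      simp only [cellPts, Finset.mem_filter, Finset.mem_univ, true_and, Finset.mem_erase]
      constructor
      · rintro ⟨h1, h2⟩; exact ⟨h1.symm, h2.symm⟩
      · rintro ⟨h1, h2⟩; exact ⟨h1.symm, h2.symm⟩
    rw [this, Finset.card_erase_of_mem (by simp [cellPts]), card_cell]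
  simp only [this]
  rw [Fintype.sum_sigma]
  simp [M2]

lemma card_part_erase {Q : Finset (Finset (Pts k))} (hP : IsPartition r k Q) (a : Pts k) :
    (Finset.univ.filter fun b : Pts k => a ≠ b ∧ b ∈ part Q a).card = r - 1 := by
  have : (Finset.univ.filter fun b : Pts k => a ≠ b ∧ b ∈ part Q a) = (part Q a).erase a := by
    ext b
    simp only [Finset.mem_filter, Finset.mem_univ, true_and, Finset.mem_erase, ne_comm]
  rw [this, Finset.card_erase_of_mem (mem_part hP a), card_part hP]

lemma card_partPairs {Q : Finset (Finset (Pts k))} (hP : IsPartition r k Q) :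
    (partPairs Q).card = Mtot k * (r - 1) := by
  unfold partPairs
  rw [card_filter_prod]
  simp only [card_part_erase hP]
  simp [Mtot]

lemma card_loopPairs {ℓ : ℕ} {Q : Finset (Finset (Pts k))} (hQ : Q ∈ Cset r k ℓ) :
    (loopPairs Q).card = 2 * ℓ := by
  obtain ⟨hP, h1, h3, h4, h5⟩ := cset_iff.1 hQ
  have : loopPairs Q = (Q.filter fun U => HasLoop U).biUnion
      fun U => U.offDiag.filter fun z => z.1.1 = z.2.1 := by
    ext ⟨a, b⟩
    simp only [loopPairs, Finset.mem_filter, Finset.mem_univ, true_and, Finset.mem_biUnion,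
      Finset.mem_offDiag]
    constructor
    · rintro ⟨h1, h2, h3⟩
      exact ⟨part Q a, ⟨part_mem hP a, a, mem_part hP a, b, h3, h1, h2⟩,
        ⟨mem_part hP a, h3, h1⟩, h2⟩
    · rintro ⟨U, ⟨hU, -⟩, ⟨ha, hb, hab⟩, h⟩
      exact ⟨hab, h, by rwa [part_eq hP hU ha]⟩
  rw [this, Finset.card_biUnion]
  · rw [Finset.sum_const_nat (m := 2)]
    · rw [← h4, mul_comm]; rfl
    · intro U hU
      obtain ⟨hU, x, hx, y, hy, hne, he⟩ := Finset.mem_filter.1 hU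
      have : (U.offDiag.filter fun z => z.1.1 = z.2.1) = {(x, y), (y, x)} := by
        ext ⟨p, q⟩
        simp only [Finset.mem_filter, Finset.mem_offDiag, Finset.mem_insert, Finset.mem_singleton,
          Prod.mk.injEq]
        constructor
        · rintro ⟨⟨hp, hq, hpq⟩, h⟩
          have e1 := (h1 U hU).eq hx hy hne he hp hq hpq h
          have e2 := (h1 U hU).eq hx hy hne he hq hp hpq.symm h.symm
          grind
        · rintro (⟨rfl, rfl⟩ | ⟨rfl, rfl⟩)
          · exact ⟨⟨hx, hy, hne⟩, he⟩
          · exact ⟨⟨hy, hx, hne.symm⟩, he.symm⟩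
      rw [this, Finset.card_pair]
      simp only [ne_eq, Prod.mk.injEq, not_and]
      exact fun h => (hne h).elim
  · intro U hU W hW hUW
    rw [Function.onFun, Finset.disjoint_left]
    rintro ⟨a, b⟩ h h'
    simp only [Finset.mem_filter, Finset.mem_offDiag, Finset.coe_filter, Set.mem_ofPred_eq] at *
    exact hUW (hP.eq hU.1 hW.1 h.1.1 h'.1.1)

end Comb3


section Comb4
variable {n : ℕ} {k : Fin n → ℕ} {r : ℕ}

/-- `C_ℓ` as a finset. -/
noncomputable def Cfin (r : ℕ) (k : Fin n → ℕ) (ℓ : ℕ) : Finset (Finset (Finset (Pts k))) :=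
  Finset.univ.filter fun Q => Q ∈ Cset r k ℓ

lemma mem_Cfin {ℓ : ℕ} {Q : Finset (Finset (Pts k))} : Q ∈ Cfin r k ℓ ↔ Q ∈ Cset r k ℓ := by
  simp [Cfin]

lemma ncard_Cset (ℓ : ℕ) : (Cset r k ℓ).ncard = (Cfin r k ℓ).card := by
  rw [← Set.ncard_coe_finset]
  congr 1
  ext Q
  simp [Cfin]

/-- Forward switchings. -/
noncomputable def Fsw (r ℓ : ℕ) (Q : Finset (Finset (Pts k))) :
    Finset ((Pts k × Pts k) × (Pts k × Pts k)) :=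
  Finset.univ.filter fun z => z.1 ∈ loopPairs Q ∧ Dist4 z.1.1 z.1.2 z.2.1 z.2.2 ∧
    actQ (dswap z.1.1 z.1.2 z.2.1 z.2.2) Q ∈ Cset r k ℓ

/-- Reverse switchings. -/
noncomputable def Gsw (r ℓ : ℕ) (Q : Finset (Finset (Pts k))) :
    Finset ((Pts k × Pts k) × (Pts k × Pts k)) :=
  Finset.univ.filter fun z => (z.1 ∈ cellPairs ∧ z.2 ∈ partPairs Q) ∧
    Dist4 z.1.1 z.1.2 z.2.1 z.2.2 ∧
    actQ (dswap z.1.1 z.1.2 z.2.1 z.2.2) Q ∈ Cset r k (ℓ + 1)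

lemma sum_F_eq (ℓ : ℕ) : ∑ Q ∈ Cfin r k (ℓ + 1), (Fsw r ℓ Q).card =
    ∑ Q ∈ Cfin r k ℓ, (Gsw r ℓ Q).card := by
  rw [← Finset.card_sigma, ← Finset.card_sigma]
  refine Finset.card_nbij'
    (fun w => ⟨actQ (dswap w.2.1.1 w.2.1.2 w.2.2.1 w.2.2.2) w.1, w.2⟩)
    (fun w => ⟨actQ (dswap w.2.1.1 w.2.1.2 w.2.2.1 w.2.2.2) w.1, w.2⟩) ?_ ?_ ?_ ?_
  · rintro ⟨Q, ⟨x₁, x₂⟩, ⟨y₁, y₂⟩⟩ h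
    simp only [Finset.coe_sigma, Set.mem_sigma_iff, Finset.mem_coe, mem_Cfin, Fsw, Gsw,
      Finset.mem_filter, Finset.mem_univ, true_and, cellPairs, partPairs, loopPairs] at h ⊢
    obtain ⟨h1, ⟨h2, h3, h4⟩, h5, h6⟩ := h
    refine ⟨h6, ⟨⟨h2, h3⟩, h5.2.1, ?_⟩, h5, ?_⟩
    · rw [mem_part_actQ, dswap_symm h5, dswap_apply h5, dswap_apply h5]
      obtain ⟨g1, g2, g3, g4, g5, g6⟩ := h5
      simpa [g1, g2, g3.symm, g4.symm, g5.symm, g6.symm, g2.symm] using h4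
    · rwa [actQ_invol _ (dswap_invol h5)]
  · rintro ⟨Q, ⟨x₁, x₂⟩, ⟨y₁, y₂⟩⟩ h
    simp only [Finset.coe_sigma, Set.mem_sigma_iff, Finset.mem_coe, mem_Cfin, Fsw, Gsw,
      Finset.mem_filter, Finset.mem_univ, true_and, cellPairs, partPairs, loopPairs] at h ⊢
    obtain ⟨h1, ⟨⟨h2, h3⟩, -, h4⟩, h5, h6⟩ := h
    refine ⟨h6, ⟨h2, h3, ?_⟩, h5, ?_⟩
    · rw [mem_part_actQ, dswap_symm h5, dswap_apply h5, dswap_apply h5]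
      obtain ⟨g1, g2, g3, g4, g5, g6⟩ := h5
      simpa [g1.symm] using h4
    · rwa [actQ_invol _ (dswap_invol h5)]
  · rintro ⟨Q, ⟨x₁, x₂⟩, ⟨y₁, y₂⟩⟩ h
    simp only [Finset.coe_sigma, Set.mem_sigma_iff, Finset.mem_coe, Fsw, 
      Finset.mem_filter] at h
    simp only [actQ_invol _ (dswap_invol h.2.2.2.1)]
  · rintro ⟨Q, ⟨x₁, x₂⟩, ⟨y₁, y₂⟩⟩ h
    simp only [Finset.coe_sigma, Set.mem_sigma_iff, Finset.mem_coe, Gsw, 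
      Finset.mem_filter] at h
    simp only [actQ_invol _ (dswap_invol h.2.2.2.1)]

lemma F_upper {ℓ : ℕ} {Q : Finset (Finset (Pts k))} (hQ : Q ∈ Cset r k (ℓ + 1)) :
    (Fsw r ℓ Q).card ≤ 2 * (ℓ + 1) * Mtot k ^ 2 := by
  have : Fsw r ℓ Q ⊆ loopPairs Q ×ˢ Finset.univ := by
    intro z hz
    simp only [Fsw, Finset.mem_filter] at hz
    simp [hz.2.1]
  refine (Finset.card_le_card this).trans ?_
  rw [Finset.card_product, card_loopPairs hQ, Finset.card_univ, Fintype.card_prod, card_pts, sq]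

lemma G_upper {ℓ : ℕ} {Q : Finset (Finset (Pts k))} (hP : IsPartition r k Q) :
    (Gsw r ℓ Q).card ≤ M2 k * (Mtot k * (r - 1)) := by
  have : Gsw r ℓ Q ⊆ cellPairs ×ˢ partPairs Q := by
    intro z hz
    simp only [Gsw, Finset.mem_filter] at hz
    simp [hz.2.1]
  refine (Finset.card_le_card this).trans ?_
  rw [Finset.card_product, card_cellPairs, card_partPairs hP]

lemma count_lower {α β : Type*} (S : Finset α) (T : Finset β) (F : Finset (α × β))
    (bad : α → Finset β) (B : ℕ) (hB : ∀ a ∈ S, (bad a).card ≤ B)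
    (h : ∀ a ∈ S, ∀ b ∈ T, b ∉ bad a → (a, b) ∈ F) :
    S.card * T.card ≤ F.card + S.card * B := by
  have hsub : S ×ˢ T ⊆ F ∪ S.biUnion fun a => {a} ×ˢ bad a := by
    rintro ⟨a, b⟩ hab
    rw [Finset.mem_product] at hab
    by_cases hb : b ∈ bad a
    · refine Finset.mem_union_right _ ?_
      simp only [Finset.mem_biUnion, Finset.mem_product, Finset.mem_singleton]
      exact ⟨a, hab.1, rfl, hb⟩
    · exact Finset.mem_union_left _ (h a hab.1 b hab.2 hb)
  rw [← Finset.card_product]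
  refine (Finset.card_le_card hsub).trans ((Finset.card_union_le _ _).trans ?_)
  gcongr
  refine Finset.card_biUnion_le_card_mul _ _ _ fun a ha => ?_
  simpa using hB a ha

lemma F_lower {ℓ : ℕ} {Q : Finset (Finset (Pts k))} (hQ : Q ∈ Cset r k (ℓ + 1)) :
    2 * (ℓ + 1) * Mtot k ^ 2 ≤ (Fsw r ℓ Q).card +
      2 * (ℓ + 1) * (Mtot k * (3 * (r ^ 3 * kmax k ^ 2) + 2 * ((ℓ + 1) * r))) := by
  obtain ⟨hP, -, -, h4, -⟩ := cset_iff.1 hQ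
  let A : Pts k → Finset (Pts k) := fun x => loopPts Q ∪ badPts Q (part Q x)
  let Z : Finset (Pts k × Pts k) := Finset.univ.filter fun z => z.2 ∈ badPts Q (part Q z.1)
  have hA : ∀ x, (A x).card ≤ (ℓ + 1) * r + r ^ 3 * kmax k ^ 2 := fun x =>
    (Finset.card_union_le _ _).trans (Nat.add_le_add (card_loopPts hP h4)
      (card_bad hP (part_mem hP x)))
  have hZ : Z.card ≤ Mtot k * (r ^ 3 * kmax k ^ 2) := by
    simp only [Z]
    rw [card_filter_prod, ← card_pts (k := k), ← Finset.card_univ, ← smul_eq_mul]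
    refine Finset.sum_le_card_nsmul _ _ _ fun a _ => ?_
    simpa using card_bad hP (part_mem hP a)
  have := count_lower (loopPairs Q) (Finset.univ : Finset (Pts k × Pts k)) (Fsw r ℓ Q)
    (fun x => ((A x.1) ×ˢ Finset.univ ∪ Finset.univ ×ˢ (A x.1)) ∪ Z)
    (Mtot k * (3 * (r ^ 3 * kmax k ^ 2) + 2 * ((ℓ + 1) * r))) ?_ ?_
  · rw [card_loopPairs hQ, Finset.card_univ, Fintype.card_prod, card_pts, ← sq] at this
    exact this
  · intro x hx
    refine (Finset.card_union_le _ _).trans ?_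
    refine (Nat.add_le_add (Finset.card_union_le _ _) hZ).trans ?_
    rw [Finset.card_product, Finset.card_product, Finset.card_univ, card_pts]
    have := Nat.mul_le_mul_left (Mtot k) (hA x.1)
    nlinarith
  · rintro ⟨x₁, x₂⟩ hx ⟨y₁, y₂⟩ - hb
    have hx' := hx
    simp only [loopPairs, Finset.mem_filter, Finset.mem_univ, true_and] at hx'
    simp only [A, Z, Finset.mem_union, Finset.mem_product, Finset.mem_univ, and_true, true_and,
      Finset.mem_filter, not_or] at hb
    have := fwd hQ hx'.1 hx'.2.1 hx'.2.2 hb.1.1.1 hb.1.2.1 hb.1.1.2 hb.1.2.2 hb.2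
    simp only [Fsw, Finset.mem_filter, Finset.mem_univ, true_and]
    exact ⟨hx, this.2, this.1⟩

lemma G_lower {ℓ : ℕ} {Q : Finset (Finset (Pts k))} (hQ : Q ∈ Cset r k ℓ)
    (hN : ℓ + 1 ≤ Nbound r k) :
    ∃ g : ℕ, M2 k ≤ g + 2 * (ℓ * r * kmax k) ∧ g ≤ M2 k ∧
      g * (Mtot k * (r - 1)) ≤ (Gsw r ℓ Q).card +
        g * ((2 * (r ^ 3 * kmax k ^ 2) + ℓ * r) * (r - 1)) := by
  obtain ⟨hP, -, -, h4, -⟩ := cset_iff.1 hQ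
  let S : Finset (Pts k × Pts k) := cellPairs.filter fun z => z.1 ∉ loopPts Q ∧ z.2 ∉ loopPts Q
  have hL := card_loopPts hP h4
  refine ⟨S.card, ?_, ?_, ?_⟩
  · rw [← card_cellPairs]
    have hsub : (cellPairs : Finset (Pts k × Pts k)) ⊆ S ∪
        (((loopPts Q).biUnion fun x => {x} ×ˢ cellPts x.1) ∪
        ((loopPts Q).biUnion fun x => cellPts x.1 ×ˢ {x})) := by
      rintro ⟨a, b⟩ h
      have h' := h
      simp only [cellPairs, Finset.mem_filter, Finset.mem_univ, true_and] at h'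
      simp only [S, Finset.mem_union, Finset.mem_filter, Finset.mem_biUnion, Finset.mem_product,
        Finset.mem_singleton, cellPts, Finset.mem_univ, true_and]
      by_cases ha : a ∈ loopPts Q
      · exact Or.inr (Or.inl ⟨a, ha, rfl, h'.2.symm⟩)
      by_cases hb : b ∈ loopPts Q
      · exact Or.inr (Or.inr ⟨b, hb, h'.2, rfl⟩)
      exact Or.inl ⟨h, ha, hb⟩
    refine (Finset.card_le_card hsub).trans ((Finset.card_union_le _ _).trans ?_)
    gcongr
    refine (Finset.card_union_le _ _).trans ?_
    rw [two_mul]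
    gcongr
    · refine (Finset.card_biUnion_le_card_mul _ _ (kmax k) fun x _ => ?_).trans ?_
      · rw [Finset.card_product, Finset.card_singleton, card_cell, one_mul]; exact k_le _
      · gcongr
    · refine (Finset.card_biUnion_le_card_mul _ _ (kmax k) fun x _ => ?_).trans ?_
      · rw [Finset.card_product, Finset.card_singleton, card_cell, mul_one]; exact k_le _
      · gcongr
  · rw [← card_cellPairs]
    exact Finset.card_le_card (Finset.filter_subset _ _)
  · let A : Pts k × Pts k → Finset (Pts k) := fun x =>
      (badPts Q (part Q x.1) ∪ badPts Q (part Q x.2)) ∪ loopPts Q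
    have hA : ∀ x, (A x).card ≤ 2 * (r ^ 3 * kmax k ^ 2) + ℓ * r := fun x => by
      refine (Finset.card_union_le _ _).trans (Nat.add_le_add ((Finset.card_union_le _ _).trans ?_) hL)
      rw [two_mul]
      exact Nat.add_le_add (card_bad hP (part_mem hP _)) (card_bad hP (part_mem hP _))
    rw [← card_partPairs hP]
    refine count_lower S (partPairs Q) (Gsw r ℓ Q)
      (fun x => (A x).biUnion fun y => {y} ×ˢ (Finset.univ.filter fun b => y ≠ b ∧ b ∈ part Q y))
      _ ?_ ?_
    · intro x _
      refine (Finset.card_biUnion_le_card_mul _ _ (r - 1) fun y _ => ?_).trans ?_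
      · rw [Finset.card_product, Finset.card_singleton, card_part_erase hP, one_mul]
      · exact Nat.mul_le_mul_right _ (hA x)
    · rintro ⟨x₁, x₂⟩ hx ⟨y₁, y₂⟩ hy hb
      have hx' := hx
      have hy' := hy
      simp only [S, cellPairs, Finset.mem_filter, Finset.mem_univ, true_and] at hx'
      simp only [partPairs, Finset.mem_filter, Finset.mem_univ, true_and] at hy'
      have hyA : y₁ ∉ A (x₁, x₂) := by
        intro h
        apply hb
        simp only [Finset.mem_biUnion, Finset.mem_product, Finset.mem_singleton, Finset.mem_filter,
          Finset.mem_univ, true_and]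
        exact ⟨y₁, h, rfl, hy'⟩
      simp only [A, Finset.mem_union, not_or] at hyA
      have := rev hQ hN hx'.1.1 hx'.1.2 hx'.2.1 hx'.2.2 hy'.1 hy'.2 hyA.2 hyA.1.1 hyA.1.2
      simp only [Gsw, Finset.mem_filter, Finset.mem_univ, true_and]
      exact ⟨⟨(Finset.mem_filter.1 hx).1, hy⟩, this.2, this.1⟩

/-- Upper ratio bound. -/
lemma ratio_upper (ℓ : ℕ) :
    (Cfin r k (ℓ + 1)).card * (2 * (ℓ + 1) * Mtot k ^ 2) ≤
      (Cfin r k ℓ).card * (M2 k * (Mtot k * (r - 1))) + (Cfin r k (ℓ + 1)).card *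
      (2 * (ℓ + 1) * (Mtot k * (3 * (r ^ 3 * kmax k ^ 2) + 2 * ((ℓ + 1) * r)))) := by
  have h1 := Finset.card_nsmul_le_sum (Cfin r k (ℓ + 1)) (fun Q => (Fsw r ℓ Q).card +
      2 * (ℓ + 1) * (Mtot k * (3 * (r ^ 3 * kmax k ^ 2) + 2 * ((ℓ + 1) * r)))) _
      (fun Q hQ => F_lower (mem_Cfin.1 hQ))
  rw [Finset.sum_add_distrib, sum_F_eq, Finset.sum_const, smul_eq_mul, smul_eq_mul] at h1
  refine h1.trans (Nat.add_le_add_right ?_ _)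
  rw [← smul_eq_mul]
  exact Finset.sum_le_card_nsmul _ _ _ fun Q hQ => G_upper (cset_iff.1 (mem_Cfin.1 hQ)).1

/-- Lower ratio bound. -/
lemma ratio_lower (ℓ : ℕ) (hN : ℓ + 1 ≤ Nbound r k) :
    (Cfin r k ℓ).card * ((M2 k - 2 * (ℓ * r * kmax k)) *
      ((Mtot k - (2 * (r ^ 3 * kmax k ^ 2) + ℓ * r)) * (r - 1))) ≤
      (Cfin r k (ℓ + 1)).card * (2 * (ℓ + 1) * Mtot k ^ 2) := by
  have h1 := Finset.card_nsmul_le_sum (Cfin r k ℓ) (fun Q => (Gsw r ℓ Q).card)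
    ((M2 k - 2 * (ℓ * r * kmax k)) * ((Mtot k - (2 * (r ^ 3 * kmax k ^ 2) + ℓ * r)) * (r - 1)))
    (fun Q hQ => by
      obtain ⟨g, hg1, -, hg⟩ := G_lower (mem_Cfin.1 hQ) hN
      calc _ ≤ g * ((Mtot k - (2 * (r ^ 3 * kmax k ^ 2) + ℓ * r)) * (r - 1)) := by
            gcongr; omega
        _ ≤ _ := by
            rw [Nat.sub_mul, Nat.mul_sub]
            omega)
  rw [← sum_F_eq, smul_eq_mul] at h1
  refine h1.trans ?_
  rw [← smul_eq_mul (a := (Cfin r k (ℓ + 1)).card)]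
  exact Finset.sum_le_card_nsmul _ _ _ fun Q hQ => F_upper (mem_Cfin.1 hQ)

end Comb4


section Analysis

lemma one_le_mul_exp {x : ℝ} (h0 : 0 ≤ x) (h1 : x ≤ 1 / 2) : 1 ≤ (1 - x) * Real.exp (2 * x) := by
  have := Real.add_one_le_exp (2 * x)
  nlinarith

lemma sum_exp_one {μ : ℝ} (h : 0 ≤ μ) (m : ℕ) :
    ∑ i ∈ Finset.range m, μ ^ i / (i.factorial : ℝ) * i ≤ μ * Real.exp μ := by
  cases m with
  | zero => simp; positivity
  | succ m =>
    rw [Finset.sum_range_succ']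
    have e : ∀ i ∈ Finset.range m, μ ^ (i + 1) / ((i + 1).factorial : ℝ) * ((i + 1 : ℕ) : ℝ) =
        μ * (μ ^ i / (i.factorial : ℝ)) := by
      intro i _
      have : (i.factorial : ℝ) ≠ 0 := by positivity
      rw [Nat.factorial_succ]
      push_cast
      field_simp
      ring
    rw [Finset.sum_congr rfl e, ← Finset.mul_sum]
    have := Real.sum_le_exp_of_nonneg h m
    simp only [CharP.cast_eq_zero, mul_zero, add_zero]
    gcongr

lemma sum_exp_two {μ : ℝ} (h : 0 ≤ μ) (m : ℕ) :
    ∑ i ∈ Finset.range m, μ ^ i / (i.factorial : ℝ) * (i * (i - 1)) ≤ μ ^ 2 * Real.exp μ := by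
  cases m with
  | zero => simp; positivity
  | succ m =>
    rw [Finset.sum_range_succ']
    have e : ∀ i ∈ Finset.range m, μ ^ (i + 1) / ((i + 1).factorial : ℝ) *
        (((i + 1 : ℕ) : ℝ) * (((i + 1 : ℕ) : ℝ) - 1)) =
        μ * (μ ^ i / (i.factorial : ℝ) * i) := by
      intro i _
      have : (i.factorial : ℝ) ≠ 0 := by positivity
      rw [Nat.factorial_succ]
      push_cast
      field_simp
      ring
    rw [Finset.sum_congr rfl e, ← Finset.mul_sum]
    have := sum_exp_one h m
    simp only [CharP.cast_eq_zero, zero_mul, mul_zero, add_zero]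
    calc _ ≤ μ * (μ * Real.exp μ) := by gcongr
      _ = _ := by ring

lemma tail_bound {lam : ℝ} (h : 0 ≤ lam) (N : ℕ) (hN : 18 * lam ≤ N) :
    Real.exp lam - Real.exp (-N) ≤ ∑ i ∈ Finset.range (N + 1), lam ^ i / (i.factorial : ℝ) := by
  have hlim : Filter.Tendsto (fun m => ∑ i ∈ Finset.range m, lam ^ i / (i.factorial : ℝ))
      Filter.atTop (nhds (Real.exp lam)) := by
    have := NormedSpace.expSeries_div_hasSum_exp (𝔸 := ℝ) lam
    rw [← Real.exp_eq_exp_ℝ] at this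
    exact this.tendsto_sum_nat
  rw [sub_le_iff_le_add]
  refine le_of_tendsto hlim (Filter.Eventually.of_forall fun m => ?_)
  set t := Real.exp 2 with ht
  have t1 : 1 ≤ t := by rw [ht]; exact Real.one_le_exp (by norm_num)
  have t8 : t ≤ 8 := by
    have h1 := Real.exp_one_lt_d9
    have h2 := Real.exp_pos 1
    have : t = Real.exp 1 * Real.exp 1 := by rw [ht, ← Real.exp_add]; norm_num
    rw [this]; nlinarith
  have hterm : ∀ i ∈ Finset.range m, lam ^ i / (i.factorial : ℝ) ≤
      (if i ∈ Finset.range (N + 1) then lam ^ i / (i.factorial : ℝ) else 0) +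
        (t ^ N)⁻¹ * ((t * lam) ^ i / (i.factorial : ℝ)) := by
    intro i _
    split_ifs with hi
    · have : 0 ≤ (t ^ N)⁻¹ * ((t * lam) ^ i / (i.factorial : ℝ)) := by positivity
      linarith
    · rw [zero_add, mul_pow]
      have hi' : N ≤ i := by rw [Finset.mem_range] at hi; omega
      have : t ^ N ≤ t ^ i := pow_le_pow_right₀ t1 hi'
      have h1 : 1 ≤ (t ^ N)⁻¹ * t ^ i := by
        rw [inv_mul_eq_div, one_le_div (by positivity)]; exact this
      have h2 : 0 ≤ lam ^ i / (i.factorial : ℝ) := by positivity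
      calc _ ≤ ((t ^ N)⁻¹ * t ^ i) * (lam ^ i / (i.factorial : ℝ)) := le_mul_of_one_le_left h2 h1
        _ = _ := by ring
  refine (Finset.sum_le_sum hterm).trans ?_
  rw [Finset.sum_add_distrib, ← Finset.mul_sum]
  gcongr ?_ + ?_
  · rw [← Finset.sum_filter]
    refine Finset.sum_le_sum_of_subset_of_nonneg ?_ fun i _ _ => by positivity
    intro i hi
    exact (Finset.mem_filter.1 hi).2
  · calc _ ≤ (t ^ N)⁻¹ * Real.exp (t * lam) := by
          gcongr
          exact Real.sum_le_exp_of_nonneg (by positivity) m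
      _ = Real.exp (t * lam - 2 * N) := by
          rw [ht, ← Real.exp_nat_mul, ← Real.exp_neg, ← Real.exp_add]
          congr 1; ring
      _ ≤ _ := by
          apply Real.exp_le_exp.2
          nlinarith

lemma upper_sum (c : ℕ → ℝ) (N : ℕ) (lam α β : ℝ) (hc : ∀ i, 0 ≤ c i) (hlam : 0 ≤ lam)
    (hα : 0 ≤ α) (hβ : 0 ≤ β) (h1 : α + β * N ≤ 1 / 2) (h2 : β * N ^ 2 ≤ 1)
    (hU : ∀ i < N, ((i : ℝ) + 1) * c (i + 1) * (1 - α - β * (i + 1)) ≤ lam * c i) :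
    ∑ i ∈ Finset.range (N + 1), c i ≤ c 0 *
      Real.exp (lam * Real.exp (2 * α + 2 * β) +
        2 * β * (lam * Real.exp (2 * α + 2 * β)) ^ 2) := by
  set μ := lam * Real.exp (2 * α + 2 * β) with hμ
  have hμ0 : 0 ≤ μ := by positivity
  have pt : ∀ i, i ≤ N → c i ≤ c 0 * (μ ^ i / (i.factorial : ℝ)) * Real.exp (β * (i * (i - 1))) := by
    intro i
    induction i with
    | zero => intro _; simp
    | succ i ih =>
      intro hi
      have ih := ih (by omega)
      have hU := hU i (by omega)
      have hiN : ((i : ℝ) + 1) ≤ N := by exact_mod_cast hi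
      set x := α + β * (i + 1) with hx
      have hx0 : 0 ≤ x := by positivity
      have hx1 : x ≤ 1 / 2 := by
        have : β * (i + 1) ≤ β * N := by gcongr
        linarith
      have hk := one_le_mul_exp hx0 hx1
      have e1 : ((i : ℝ) + 1) * c (i + 1) ≤ lam * c i * Real.exp (2 * x) := by
        calc ((i : ℝ) + 1) * c (i + 1) ≤ ((i : ℝ) + 1) * c (i + 1) * ((1 - x) * Real.exp (2 * x)) :=
              le_mul_of_one_le_right (mul_nonneg (by positivity) (hc _)) hk
          _ = (((i : ℝ) + 1) * c (i + 1) * (1 - α - β * (i + 1))) * Real.exp (2 * x) := by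
              rw [hx]; ring
          _ ≤ _ := by gcongr
      have e2 : c (i + 1) ≤ lam * c i * Real.exp (2 * x) / (i + 1) := by
        rw [le_div_iff₀ (by positivity)]; linarith
      refine e2.trans ?_
      have e3 : Real.exp (2 * x) * Real.exp (β * (i * (i - 1))) = Real.exp (2 * α + 2 * β) *
          Real.exp (β * (((i + 1 : ℕ) : ℝ) * (((i + 1 : ℕ) : ℝ) - 1))) := by
        rw [← Real.exp_add, ← Real.exp_add]
        congr 1
        push_cast
        rw [hx]; ring
      have : (i.factorial : ℝ) ≠ 0 := by positivity
      calc lam * c i * Real.exp (2 * x) / (i + 1) ≤ lam *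
            (c 0 * (μ ^ i / (i.factorial : ℝ)) * Real.exp (β * (i * (i - 1)))) *
            Real.exp (2 * x) / (i + 1) := by gcongr
        _ = lam * c 0 * (μ ^ i / (i.factorial : ℝ)) / (i + 1) *
            (Real.exp (2 * x) * Real.exp (β * (i * (i - 1)))) := by ring
        _ = _ := by
            rw [e3, Nat.factorial_succ, pow_succ]
            push_cast
            rw [hμ]
            field_simp
  have pt2 : ∀ i ∈ Finset.range (N + 1), c i ≤ c 0 * (μ ^ i / (i.factorial : ℝ) +
      2 * β * (μ ^ i / (i.factorial : ℝ) * (i * (i - 1)))) := by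
    intro i hi
    have hi : i ≤ N := by rw [Finset.mem_range] at hi; omega
    refine (pt i hi).trans ?_
    have hy0 : (0 : ℝ) ≤ i * (i - 1) := by
      rcases Nat.eq_zero_or_pos i with h | h
      · simp [h]
      · have : (1 : ℝ) ≤ i := by exact_mod_cast h
        nlinarith
    have hy : 0 ≤ β * (i * (i - 1) : ℝ) := by positivity
    have hiN : (i : ℝ) ≤ N := by exact_mod_cast hi
    have hy1 : β * (i * (i - 1) : ℝ) ≤ 1 := by
      have : (i * (i - 1) : ℝ) ≤ N ^ 2 := by nlinarith
      calc _ ≤ β * N ^ 2 := by gcongr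
        _ ≤ 1 := h2
    have hexp : Real.exp (β * (i * (i - 1))) ≤ 1 + 2 * (β * (i * (i - 1))) := by
      have := Real.abs_exp_sub_one_sub_id_le (x := β * (i * (i - 1))) (by rw [abs_of_nonneg hy]; exact hy1)
      have := (abs_le.1 this).2
      nlinarith
    have hc0 := hc 0
    calc _ ≤ c 0 * (μ ^ i / (i.factorial : ℝ)) * (1 + 2 * (β * (i * (i - 1)))) := by gcongr
      _ = _ := by ring
  refine (Finset.sum_le_sum pt2).trans ?_
  rw [← Finset.mul_sum]
  refine mul_le_mul_of_nonneg_left ?_ (hc 0)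
  rw [Finset.sum_add_distrib, ← Finset.mul_sum, Real.exp_add]
  have a1 := Real.sum_le_exp_of_nonneg hμ0 (N + 1)
  have a2 := sum_exp_two hμ0 (N + 1)
  have a3 := Real.add_one_le_exp (2 * β * μ ^ 2)
  calc _ ≤ Real.exp μ + 2 * β * (μ ^ 2 * Real.exp μ) := by gcongr
    _ = Real.exp μ * (2 * β * μ ^ 2 + 1) := by ring
    _ ≤ _ := by gcongr

lemma lower_sum (c : ℕ → ℝ) (N : ℕ) (lam α b : ℝ) (hc : ∀ i, 0 ≤ c i) (hlam : 0 ≤ lam)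
    (hα : 0 ≤ α) (hb : 0 ≤ b) (hN : 18 * lam ≤ N)
    (hL : ∀ i < N, lam * c i * (1 - α - b * i) ≤ ((i : ℝ) + 1) * c (i + 1)) :
    c 0 * (Real.exp lam * (1 - (Real.exp (-N) + α * lam + b / 2 * lam ^ 2))) ≤
      ∑ i ∈ Finset.range (N + 1), c i := by
  have pt : ∀ i, i ≤ N → c 0 * (lam ^ i / (i.factorial : ℝ)) *
      (1 - α * i - b / 2 * (i * (i - 1))) ≤ c i := by
    intro i
    induction i with
    | zero => intro _; simp
    | succ i ih =>
      intro hi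
      have ih := ih (by omega)
      have hL := hL i (by omega)
      have hfac : (0 : ℝ) < (i.factorial : ℝ) := by positivity
      have hy0 : (0 : ℝ) ≤ i * (i - 1) := by
        rcases Nat.eq_zero_or_pos i with h | h
        · simp [h]
        · have : (1 : ℝ) ≤ i := by exact_mod_cast h
          nlinarith
      have hc0 := hc 0
      have hP : 0 ≤ c 0 * (lam ^ i / (i.factorial : ℝ)) := by positivity
      set s := α * i + b / 2 * (i * (i - 1)) with hs
      set u := α + b * i with hu
      have hs0 : 0 ≤ s := by positivity
      have hu0 : 0 ≤ u := by positivity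
      have goal' : c 0 * (lam ^ (i + 1) / ((i + 1).factorial : ℝ)) *
          (1 - α * ((i + 1 : ℕ) : ℝ) - b / 2 * (((i + 1 : ℕ) : ℝ) * (((i + 1 : ℕ) : ℝ) - 1))) =
          lam * (c 0 * (lam ^ i / (i.factorial : ℝ))) * (1 - s - u) / (i + 1) := by
        rw [Nat.factorial_succ, pow_succ, hs, hu]
        push_cast
        field_simp
        ring
      rw [goal', div_le_iff₀ (by positivity)]
      by_cases h1 : u ≤ 1
      · calc _ ≤ lam * (c 0 * (lam ^ i / (i.factorial : ℝ))) * ((1 - s) * (1 - u)) := by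
              gcongr
              nlinarith
          _ = lam * (c 0 * (lam ^ i / (i.factorial : ℝ)) * (1 - α * i - b / 2 * (i * (i - 1)))) *
              (1 - u) := by rw [hs]; ring
          _ ≤ lam * c i * (1 - u) := by
              have : 0 ≤ 1 - u := by linarith
              gcongr
          _ = lam * c i * (1 - α - b * i) := by rw [hu]; ring
          _ ≤ _ := by linarith
      · have : 1 - s - u ≤ 0 := by linarith
        have h3 : lam * (c 0 * (lam ^ i / (i.factorial : ℝ))) * (1 - s - u) ≤ 0 :=
          mul_nonpos_of_nonneg_of_nonpos (by positivity) this
        have := hc (i + 1)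
        refine h3.trans (by positivity)
  have pt2 : ∀ i ∈ Finset.range (N + 1), c 0 * (lam ^ i / (i.factorial : ℝ) -
      α * (lam ^ i / (i.factorial : ℝ) * i) -
      b / 2 * (lam ^ i / (i.factorial : ℝ) * (i * (i - 1)))) ≤ c i := by
    intro i hi
    refine le_trans (le_of_eq ?_) (pt i (by rw [Finset.mem_range] at hi; omega))
    ring
  refine le_trans ?_ (Finset.sum_le_sum pt2)
  rw [← Finset.mul_sum]
  refine mul_le_mul_of_nonneg_left ?_ (hc 0)
  rw [Finset.sum_sub_distrib, Finset.sum_sub_distrib, ← Finset.mul_sum, ← Finset.mul_sum]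
  have a1 := tail_bound hlam N hN
  have a2 := mul_le_mul_of_nonneg_left (sum_exp_one hlam (N + 1)) hα
  have a3 := mul_le_mul_of_nonneg_left (sum_exp_two hlam (N + 1)) (by positivity : 0 ≤ b / 2)
  have a4 : Real.exp (-N) ≤ Real.exp lam * Real.exp (-N) :=
    le_mul_of_one_le_left (Real.exp_pos _).le (Real.one_le_exp hlam)
  nlinarith

lemma eventually_log (r : ℕ) (hr : 3 ≤ r) : ∃ M₀ : ℕ, ∀ M : ℕ, M₀ ≤ M →
    1 ≤ Real.log M ∧ (Real.log M + 1) ^ 2 ≤ (M : ℝ) / (8 * r) := by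
  have hr0 : (0 : ℝ) < r := by exact_mod_cast (by omega : 0 < r)
  have h1 := (Real.isLittleO_pow_log_id_atTop (n := 2)).bound
    (show (0 : ℝ) < 1 / (32 * r) by positivity)
  have h2 := Real.tendsto_log_atTop.eventually_ge_atTop 1
  have h3 := tendsto_natCast_atTop_atTop (R := ℝ) |>.eventually (h1.and h2)
  obtain ⟨M₀, h⟩ := Filter.eventually_atTop.1 h3
  refine ⟨M₀, fun M hM => ?_⟩
  obtain ⟨g1, g2⟩ := h M hM
  refine ⟨g2, ?_⟩
  simp only [id, Real.norm_eq_abs, abs_pow, sq_abs, Nat.abs_cast] at g1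
  have e1 : (M : ℝ) / (8 * (r : ℝ)) = 4 * (1 / (32 * (r : ℝ)) * (M : ℝ)) := by
    field_simp
    ring
  rw [e1]
  nlinarith

end Analysis


lemma M2_le {n : ℕ} (k : Fin n → ℕ) : M2 k ≤ kmax k * Mtot k := by
  unfold M2 Mtot
  rw [Finset.mul_sum]
  refine Finset.sum_le_sum fun i _ => ?_
  rw [mul_comm]
  exact Nat.mul_le_mul_right _ ((Nat.sub_le _ _).trans (k_le i))

lemma M2_pos {n : ℕ} (k : Fin n → ℕ) (h : 2 ≤ kmax k) : 0 < M2 k := by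
  have : ∃ i, 2 ≤ k i := by
    by_contra hc
    push Not at hc
    have : kmax k ≤ 1 := Finset.sup_le fun i _ => by have := hc i; omega
    omega
  obtain ⟨i, hi⟩ := this
  refine lt_of_lt_of_le (?_ : 0 < k i * (k i - 1))
    (Finset.single_le_sum (f := fun i => k i * (k i - 1)) (fun _ _ => Nat.zero_le _)
      (Finset.mem_univ i))
  exact Nat.mul_pos (by omega) (by omega)

/-- The real-number form of the two ratio bounds. -/
lemma ratio_real {n : ℕ} (r : ℕ) (hr : 3 ≤ r) (k : Fin n → ℕ) (hM : 0 < Mtot k) (hM2 : 0 < M2 k) :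
    (∀ i : ℕ, ((i : ℝ) + 1) * ((Cfin r k (i + 1)).card : ℝ) *
      (1 - 3 * r ^ 3 * (kmax k : ℝ) ^ 2 / Mtot k - 2 * r / Mtot k * (i + 1)) ≤
      ((r : ℝ) - 1) * M2 k / (2 * Mtot k) * ((Cfin r k i).card : ℝ)) ∧
    (∀ i < Nbound r k, ((r : ℝ) - 1) * M2 k / (2 * Mtot k) * ((Cfin r k i).card : ℝ) *
      (1 - 3 * r ^ 3 * (kmax k : ℝ) ^ 2 / Mtot k -
        (2 * r / Mtot k + 2 * r * kmax k / M2 k) * i) ≤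
      ((i : ℝ) + 1) * ((Cfin r k (i + 1)).card : ℝ)) := by
  have hM' : (0 : ℝ) < Mtot k := by exact_mod_cast hM
  have hM2' : (0 : ℝ) < M2 k := by exact_mod_cast hM2
  have hr1 : ((r - 1 : ℕ) : ℝ) = (r : ℝ) - 1 := by
    rw [Nat.cast_sub (by omega)]; simp
  have hr0 : (0 : ℝ) ≤ (r : ℝ) - 1 := by rw [← hr1]; positivity
  constructor
  · intro i
    have h := ratio_upper (r := r) (k := k) i
    have h : ((Cfin r k (i + 1)).card : ℝ) * (2 * (i + 1) * (Mtot k : ℝ) ^ 2) ≤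
      ((Cfin r k i).card : ℝ) * (M2 k * (Mtot k * ((r : ℝ) - 1))) + ((Cfin r k (i + 1)).card : ℝ) *
      (2 * (i + 1) * (Mtot k * (3 * (r ^ 3 * (kmax k : ℝ) ^ 2) + 2 * ((i + 1) * r)))) := by
      rw [← hr1]; exact_mod_cast h
    have e1 : ((i : ℝ) + 1) * ((Cfin r k (i + 1)).card : ℝ) *
      (1 - 3 * r ^ 3 * (kmax k : ℝ) ^ 2 / Mtot k - 2 * r / Mtot k * (i + 1)) =
      (((Cfin r k (i + 1)).card : ℝ) * (2 * (i + 1) * (Mtot k : ℝ) ^ 2) -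
        ((Cfin r k (i + 1)).card : ℝ) * (2 * (i + 1) * (Mtot k *
        (3 * (r ^ 3 * (kmax k : ℝ) ^ 2) + 2 * ((i + 1) * r))))) / (2 * (Mtot k : ℝ) ^ 2) := by
      field_simp
      ring
    have e2 : ((r : ℝ) - 1) * M2 k / (2 * Mtot k) * ((Cfin r k i).card : ℝ) =
      (((Cfin r k i).card : ℝ) * (M2 k * (Mtot k * ((r : ℝ) - 1)))) / (2 * (Mtot k : ℝ) ^ 2) := by
      field_simp
    rw [e1, e2]
    gcongr
    linarith
  · intro i hi
    have h := ratio_lower (r := r) (k := k) i hi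
    set X : ℕ := M2 k - 2 * (i * r * kmax k) with hX
    set Y : ℕ := Mtot k - (2 * (r ^ 3 * kmax k ^ 2) + i * r) with hY
    have h : ((Cfin r k i).card : ℝ) * (X * (Y * ((r : ℝ) - 1))) ≤
      ((Cfin r k (i + 1)).card : ℝ) * (2 * (i + 1) * (Mtot k : ℝ) ^ 2) := by
      rw [← hr1]; exact_mod_cast h
    have hXn : M2 k ≤ X + 2 * (i * r * kmax k) := by omega
    have hYn : Mtot k ≤ Y + (2 * (r ^ 3 * kmax k ^ 2) + i * r) := by omega
    have hX1 : (M2 k : ℝ) ≤ X + 2 * (i * r * kmax k) := by exact_mod_cast hXn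
    have hY1 : (Mtot k : ℝ) ≤ Y + (2 * (r ^ 3 * (kmax k : ℝ) ^ 2) + i * r) := by exact_mod_cast hYn
    have hX2 : (X : ℝ) ≤ M2 k := by exact_mod_cast Nat.sub_le _ _
    have hY2 : (Y : ℝ) ≤ Mtot k := by exact_mod_cast Nat.sub_le _ _
    -- normalised
    set x : ℝ := X / M2 k with hx
    set y : ℝ := Y / Mtot k with hy
    have hx1 : x ≤ 1 := by rw [hx, div_le_one hM2']; exact hX2
    have hy1 : y ≤ 1 := by rw [hy, div_le_one hM']; exact hY2
    have hxl : 1 - 2 * r * kmax k / M2 k * i ≤ x := by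
      rw [hx, le_div_iff₀ hM2', sub_mul]
      have : 2 * (r : ℝ) * kmax k / M2 k * i * M2 k = 2 * (i * r * kmax k) := by field_simp
      linarith
    have hyl : 1 - 3 * r ^ 3 * (kmax k : ℝ) ^ 2 / Mtot k - 2 * r / Mtot k * i ≤ y := by
      rw [hy, le_div_iff₀ hM', sub_mul, sub_mul]
      have e1 : 3 * (r : ℝ) ^ 3 * (kmax k : ℝ) ^ 2 / Mtot k * Mtot k =
        3 * (r : ℝ) ^ 3 * (kmax k : ℝ) ^ 2 := by field_simp
      have e2 : 2 * (r : ℝ) / Mtot k * i * Mtot k = 2 * r * i := by field_simp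
      have e3 : (0 : ℝ) ≤ r ^ 3 * (kmax k : ℝ) ^ 2 := by positivity
      have e4 : (0 : ℝ) ≤ r * i := by positivity
      nlinarith
    have hxy : 1 - 3 * r ^ 3 * (kmax k : ℝ) ^ 2 / Mtot k -
        (2 * r / Mtot k + 2 * r * kmax k / M2 k) * i ≤ x * y := by
      nlinarith
    calc _ ≤ ((r : ℝ) - 1) * M2 k / (2 * Mtot k) * ((Cfin r k i).card : ℝ) * (x * y) := by gcongr
      _ = (((Cfin r k i).card : ℝ) * (X * (Y * ((r : ℝ) - 1)))) / (2 * (Mtot k : ℝ) ^ 2) := by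
          rw [hx, hy]; field_simp
      _ ≤ (((Cfin r k (i + 1)).card : ℝ) * (2 * (i + 1) * (Mtot k : ℝ) ^ 2)) /
          (2 * (Mtot k : ℝ) ^ 2) := by gcongr
      _ = _ := by field_simp

set_option maxHeartbeats 4000000 in
/-- summing over ℓ (Lemma 7 of the paper). -/
theorem Cset_sum (r : ℕ) (hr : 3 ≤ r) :
    ∃ C δ : ℝ, ∃ M₀ : ℕ, 0 < C ∧ 0 < δ ∧
      ∀ (n : ℕ) (k : Fin n → ℕ),
        M₀ ≤ Mtot k → r ∣ Mtot k → 2 ≤ kmax k → (kmax k : ℝ) ^ 3 ≤ δ * (Mtot k : ℝ) →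
        ∃ E : ℝ, |E| ≤ C * (kmax k : ℝ) ^ 3 / (Mtot k : ℝ) ∧
          (∑ ℓ ∈ Finset.range (Nbound r k + 1), (Set.ncard (Cset r k ℓ) : ℝ)) =
            (Set.ncard (Cset r k 0) : ℝ) *
              Real.exp (((r : ℝ) - 1) * (M2 k : ℝ) / (2 * (Mtot k : ℝ)) + E) := by
  obtain ⟨M₀, hM₀⟩ := eventually_log r hr
  have hr3 : (3 : ℝ) ≤ r := by exact_mod_cast hr
  have hr0 : (0 : ℝ) < r := by linarith
  refine ⟨28 * r ^ 4, 1 / (800 * r ^ 4), M₀, by positivity, by positivity, ?_⟩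
  intro n k hMk _ hk hδ
  obtain ⟨hlog1, hlog2⟩ := hM₀ _ hMk
  have hMpos : 0 < Mtot k := by
    rcases Nat.eq_zero_or_pos (Mtot k) with h | h
    · rw [h] at hlog1; norm_num at hlog1
    · exact h
  have hM2pos := M2_pos k hk
  obtain ⟨hU, hL⟩ := ratio_real r hr k hMpos hM2pos
  simp only [ncard_Cset]
  have hM2K : (M2 k : ℝ) ≤ kmax k * Mtot k := by exact_mod_cast M2_le k
  have hM : (0 : ℝ) < Mtot k := by exact_mod_cast hMpos
  have hM2 : (0 : ℝ) < M2 k := by exact_mod_cast hM2pos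
  have hK : (2 : ℝ) ≤ kmax k := by exact_mod_cast hk
  have hNdef : Nbound r k = max ⌈Real.log (Mtot k)⌉₊
    ⌈(9 * ((r : ℝ) - 1) * (M2 k : ℝ)) / (Mtot k : ℝ)⌉₊ := rfl
  generalize hNN : Nbound r k = N at *
  generalize (kmax k : ℝ) = K at *
  have hMe : (1 : ℝ) / Mtot k = Real.exp (-Real.log (Mtot k)) := by
    rw [Real.exp_neg, Real.exp_log hM, one_div]
  generalize (M2 k : ℝ) = m2 at *
  generalize (Mtot k : ℝ) = M at *
  -- facts on N
  have hN1 : Real.log M ≤ N := by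
    rw [hNdef]; push_cast; exact le_max_of_le_left (Nat.le_ceil _)
  have hN2 : 9 * ((r : ℝ) - 1) * m2 / M ≤ N := by
    rw [hNdef]; push_cast; exact le_max_of_le_right (Nat.le_ceil _)
  have hNone : (1 : ℝ) ≤ N := hlog1.trans hN1
  have hm2M : m2 / M ≤ K := by rw [div_le_iff₀ hM]; exact hM2K
  have hm2M0 : 0 ≤ m2 / M := by positivity
  have hK23 : K ^ 2 ≤ K ^ 3 := by nlinarith [sq_nonneg K]
  have hK13 : K ≤ K ^ 3 := by nlinarith [sq_nonneg K]
  have hK03 : 1 ≤ K ^ 3 := by linarith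
  have hr34 : (r : ℝ) ^ 3 ≤ r ^ 4 := pow_le_pow_right₀ (by linarith) (by norm_num)
  have hr24 : (r : ℝ) ^ 2 ≤ r ^ 4 := pow_le_pow_right₀ (by linarith) (by norm_num)
  have hr04 : (1 : ℝ) ≤ r ^ 4 := one_le_pow₀ (by linarith)
  set t : ℝ := K ^ 3 / M with ht
  have ht0 : 0 ≤ t := by positivity
  have htδ : r ^ 4 * t ≤ 1 / 800 := by
    have : t ≤ 1 / (800 * r ^ 4) := by rw [ht, div_le_iff₀ hM]; exact hδ
    calc r ^ 4 * t ≤ r ^ 4 * (1 / (800 * r ^ 4)) := by gcongr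
      _ = _ := by field_simp
  have hK2t : K ^ 2 / M ≤ t := by rw [ht]; gcongr
  have hK1t : K / M ≤ t := by rw [ht]; gcongr
  have hK0t : 1 / M ≤ t := by rw [ht]; gcongr
  have hr3t : (r : ℝ) ^ 3 * t ≤ r ^ 4 * t := by gcongr
  have hr2t : (r : ℝ) ^ 2 * t ≤ r ^ 4 * t := by gcongr
  have hr0t : t ≤ r ^ 4 * t := le_mul_of_one_le_left ht0 hr04
  have hNsq : (N : ℝ) ^ 2 ≤ M / (8 * r) := by
    have hcase : (N : ℝ) ≤ Real.log M + 1 ∨ (N : ℝ) ≤ 10 * r * K := by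
      rcases max_choice ⌈Real.log M⌉₊ ⌈(9 * ((r : ℝ) - 1) * m2) / M⌉₊ with h | h
      · left
        rw [hNdef, h]
        exact (Nat.ceil_lt_add_one (by linarith)).le
      · right
        rw [hNdef, h]
        have h0 : 0 ≤ 9 * ((r : ℝ) - 1) * m2 / M := by
          have : 0 ≤ (r : ℝ) - 1 := by linarith
          positivity
        refine (Nat.ceil_lt_add_one h0).le.trans ?_
        have : 9 * ((r : ℝ) - 1) * m2 / M = 9 * ((r : ℝ) - 1) * (m2 / M) := by ring
        rw [this]
        have : 9 * ((r : ℝ) - 1) * (m2 / M) ≤ 9 * r * K := by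
          have : 0 ≤ (r : ℝ) - 1 := by linarith
          gcongr
          linarith
        nlinarith
    rcases hcase with h | h
    · refine le_trans ?_ hlog2
      gcongr
    · calc (N : ℝ) ^ 2 ≤ (10 * r * K) ^ 2 := by gcongr
        _ = 100 * r ^ 2 * K ^ 2 := by ring
        _ = 100 * r ^ 2 * (K ^ 2 / M) * M := by field_simp
        _ ≤ 100 * r ^ 2 * t * M := by gcongr
        _ = 100 * (r ^ 3 * t) * M / r := by field_simp
        _ ≤ 100 * (1 / 800) * M / r := by gcongr; linarith
        _ = _ := by field_simp; norm_num
  -- the parameters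
  set lam : ℝ := ((r : ℝ) - 1) * m2 / (2 * M) with hlam
  have hr1 : 0 ≤ (r : ℝ) - 1 := by linarith
  have hlam0 : 0 ≤ lam := by positivity
  have hlamK : lam ≤ r * K / 2 := by
    calc lam = ((r : ℝ) - 1) * (m2 / M) / 2 := by rw [hlam]; field_simp
      _ ≤ r * K / 2 := by gcongr; linarith
  set α : ℝ := 3 * r ^ 3 * K ^ 2 / M with hα
  set β : ℝ := 2 * r / M with hβ
  set γ : ℝ := 2 * r * K / m2 with hγ
  have hα0 : 0 ≤ α := by positivity
  have hβ0 : 0 ≤ β := by positivity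
  have hγ0 : 0 ≤ γ := by positivity
  have hβN2 : β * N ^ 2 ≤ 1 / 4 := by
    calc β * N ^ 2 ≤ β * (M / (8 * r)) := by gcongr
      _ = 1 / 4 := by rw [hβ]; field_simp; norm_num
  have hβN : β * N ≤ 1 / 4 := by
    refine le_trans ?_ hβN2
    gcongr
    nlinarith
  have hβ1 : β ≤ 1 / 4 := le_trans (by nlinarith) hβN
  have hα1 : α ≤ 1 / 4 := by
    calc α = 3 * r ^ 3 * (K ^ 2 / M) := by rw [hα]; ring
      _ ≤ 3 * r ^ 3 * t := by gcongr
      _ ≤ 1 / 4 := by linarith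
  have hαlam : α * lam ≤ 3 / 2 * (r ^ 4 * t) := by
    calc α * lam ≤ α * (r * K / 2) := by gcongr
      _ = _ := by rw [hα, ht]; ring
  have hβlam : β * lam ≤ r ^ 4 * t := by
    calc β * lam ≤ β * (r * K / 2) := by gcongr
      _ = r ^ 2 * (K / M) := by rw [hβ]; ring
      _ ≤ r ^ 2 * t := by gcongr
      _ ≤ _ := hr2t
  have hβlam2 : β * lam ^ 2 ≤ r ^ 4 * t := by
    calc β * lam ^ 2 ≤ β * (r * K / 2) ^ 2 := by gcongr
      _ = r ^ 3 * (K ^ 2 / M) / 2 := by rw [hβ]; ring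
      _ ≤ r ^ 3 * t / 2 := by gcongr
      _ ≤ _ := by nlinarith
  have hγlam2 : γ * lam ^ 2 ≤ r ^ 4 * t := by
    calc γ * lam ^ 2 = r * K * ((r : ℝ) - 1) * lam / M := by
          rw [sq]
          nth_rewrite 1 [hlam]
          rw [hγ]; field_simp
      _ ≤ r * K * r * (r * K / 2) / M := by gcongr; linarith
      _ = r ^ 3 * (K ^ 2 / M) / 2 := by ring
      _ ≤ r ^ 3 * t / 2 := by gcongr
      _ ≤ _ := by nlinarith
  have hexpN : Real.exp (-N) ≤ r ^ 4 * t := by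
    calc Real.exp (-N) ≤ Real.exp (-Real.log M) := by gcongr
      _ = 1 / M := hMe.symm
      _ ≤ t := hK0t
      _ ≤ _ := hr0t
  have hup := upper_sum (fun i => ((Cfin r k i).card : ℝ)) N lam α β (fun i => by positivity)
    hlam0 hα0 hβ0 (by linarith) (by linarith) (fun i _ => hU i)
  have hlow := lower_sum (fun i => ((Cfin r k i).card : ℝ)) N lam α (β + γ)
    (fun i => by positivity) hlam0 hα0 (by positivity) (by
      calc 18 * lam = 9 * ((r : ℝ) - 1) * m2 / M := by rw [hlam]; field_simp; ring
        _ ≤ N := hN2) (fun i hi => hL i hi)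
  set S : ℝ := ∑ i ∈ Finset.range (N + 1), ((Cfin r k i).card : ℝ) with hS
  have hc0 : (0 : ℝ) ≤ ((Cfin r k 0).card : ℝ) := by positivity
  generalize ((Cfin r k 0).card : ℝ) = c0 at *
  -- exponent bounds
  set x : ℝ := Real.exp (-N) + α * lam + (β + γ) / 2 * lam ^ 2 with hx
  have hx0 : 0 ≤ x := by positivity
  have hx1 : x ≤ 4 * (r ^ 4 * t) := by rw [hx]; nlinarith
  have hxe := one_le_mul_exp hx0 (by linarith)
  have hlow' : c0 * Real.exp (lam - 2 * x) ≤ S := by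
    refine le_trans ?_ hlow
    gcongr
    rw [sub_eq_add_neg, Real.exp_add, Real.exp_neg]
    gcongr
    rw [inv_le_iff_one_le_mul₀ (Real.exp_pos _)]
    exact hxe
  set μ : ℝ := lam * Real.exp (2 * α + 2 * β) with hμ
  have hz0 : 0 ≤ 2 * α + 2 * β := by positivity
  have hz1 : 2 * α + 2 * β ≤ 1 := by linarith
  have hexpz : Real.exp (2 * α + 2 * β) ≤ 1 + 2 * (2 * α + 2 * β) := by
    have := Real.abs_exp_sub_one_sub_id_le (x := 2 * α + 2 * β) (by rw [abs_of_nonneg hz0]; exact hz1)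
    have := (abs_le.1 this).2
    nlinarith
  have hμ1 : μ ≤ lam + 4 * (α * lam) + 4 * (β * lam) := by
    calc μ ≤ lam * (1 + 2 * (2 * α + 2 * β)) := by rw [hμ]; gcongr
      _ = _ := by ring
  have hμ3 : μ ≤ 3 * lam := by
    calc μ ≤ lam * 3 := by rw [hμ]; gcongr; linarith
      _ = _ := by ring
  have hμ0 : 0 ≤ μ := by positivity
  have hμ2 : 2 * β * μ ^ 2 ≤ 18 * (r ^ 4 * t) := by
    calc 2 * β * μ ^ 2 ≤ 2 * β * (3 * lam) ^ 2 := by gcongr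
      _ = 18 * (β * lam ^ 2) := by ring
      _ ≤ _ := by gcongr
  have hup' : S ≤ c0 * Real.exp (lam + 28 * (r ^ 4 * t)) := by
    exact hup.trans (mul_le_mul_of_nonneg_left (Real.exp_le_exp.2 (by linarith)) hc0)
  have hCt : 28 * (r : ℝ) ^ 4 * K ^ 3 / M = 28 * (r ^ 4 * t) := by rw [ht]; ring
  rcases hc0.eq_or_lt with h0 | h0
  · refine ⟨0, by rw [abs_zero, hCt]; positivity, ?_⟩
    rw [← h0] at hup' hlow' ⊢
    linarith
  · have hSpos : 0 < S := lt_of_lt_of_le (mul_pos h0 (Real.exp_pos _)) hlow'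
    have hq : 0 < S / c0 := div_pos hSpos h0
    clear_value S
    refine ⟨Real.log (S / c0) - lam, ?_, ?_⟩
    · rw [hCt, abs_le]
      constructor
      · have : lam - 2 * x ≤ Real.log (S / c0) := by
          rw [Real.le_log_iff_exp_le hq, le_div_iff₀ h0]; linarith
        linarith
      · have : Real.log (S / c0) ≤ lam + 28 * (r ^ 4 * t) := by
          rw [Real.log_le_iff_le_exp hq, div_le_iff₀ h0]; linarith
        linarith
    · rw [add_sub_cancel, Real.exp_log hq]
      field_simp
end

section
/- Let N ≥ 2 be an integer and for 1 ≤ i ≤ N let real numbers A(i), C(i) be given with A(i) ≥ 0 and A(i) − (i−1)C(i) ≥ 0. Set A_1 = min_i A(i), A_2 = max_i A(i), C_1 = min_i C(i), C_2 = max_i C(i), and suppose there is a real ĉ with 0 < ĉ < 1/3 such that max{A_2/N, |C_1|, |C_2|} ≤ ĉ. Define n_0 = 1 and n_i = (1/i)(A(i) − (i−1)C(i))·n_{i−1} for 1 ≤ i ≤ N. Then exp(A_1 − (1/2)A_1C_2) − (2eĉ)^N ≤ Σ_{i=0}^N n_i ≤ exp(A_2 − (1/2)A_2C_1 + (1/2)A_2C_1^2)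 + (2eĉ)^N. -/
open scoped Classical BigOperators

/-- The terms of the comparison series. -/
noncomputable def ttSeq (a c : ℝ) : ℕ → ℝ
  | 0 => 1
  | n + 1 => (a - n * c) / (n + 1) * ttSeq a c n

lemma log_lower_aux (c : ℝ) (h1 : -1 / 3 < c) :
    (0 ≤ c → c - c ^ 2 / 2 ≤ Real.log (1 + c) ∧ Real.log (1 + c) ≤ c - c ^ 2 / 2 + c ^ 3 / 2) ∧
    (c ≤ 0 → Real.log (1 + c) ≤ c - c ^ 2 / 2 ∧ c - c ^ 2 / 2 + c ^ 3 / 2 ≤ Real.log (1 + c)) := by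
  have hd : ∀ x ∈ Set.Ioi (-1 / 3 : ℝ), HasDerivAt (fun x : ℝ => Real.log (1 + x)) (1 / (1 + x)) x := by
    intro x hx
    have hx' : (-1 / 3 : ℝ) < x := hx
    have : HasDerivAt (fun x : ℝ => 1 + x) 1 x := by simpa using (hasDerivAt_id x).const_add 1
    exact this.log (by linarith)
  have hg : ∀ x ∈ Set.Ioi (-1 / 3 : ℝ), HasDerivAt (fun x : ℝ => Real.log (1 + x) - (x - x ^ 2 / 2))
      (1 / (1 + x) - (1 - x)) x := by
    intro x hx
    have h2 : HasDerivAt (fun x : ℝ => x - x ^ 2 / 2) (1 - x) x := by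
      have := (hasDerivAt_id x).sub ((hasDerivAt_pow 2 x).div_const 2)
      convert! this using 1
      simp
    exact (hd x hx).sub h2
  have hh : ∀ x ∈ Set.Ioi (-1 / 3 : ℝ),
      HasDerivAt (fun x : ℝ => (x - x ^ 2 / 2 + x ^ 3 / 2) - Real.log (1 + x))
      ((1 - x + 3 * x ^ 2 / 2) - 1 / (1 + x)) x := by
    intro x hx
    have h2 : HasDerivAt (fun x : ℝ => x - x ^ 2 / 2 + x ^ 3 / 2) (1 - x + 3 * x ^ 2 / 2) x := by
      have := ((hasDerivAt_id x).sub ((hasDerivAt_pow 2 x).div_const 2)).add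
        ((hasDerivAt_pow 3 x).div_const 2)
      convert! this using 1
      simp
    exact h2.sub (hd x hx)
  have mg : MonotoneOn (fun x : ℝ => Real.log (1 + x) - (x - x ^ 2 / 2)) (Set.Ioi (-1 / 3 : ℝ)) := by
    apply monotoneOn_of_deriv_nonneg (convex_Ioi _)
      (fun x hx => (hg x hx).continuousAt.continuousWithinAt)
    · intro x hx
      rw [interior_Ioi] at hx
      exact (hg x hx).differentiableAt.differentiableWithinAt
    · intro x hx
      rw [interior_Ioi] at hx
      rw [(hg x hx).deriv]
      have hx' : (-1 / 3 : ℝ) < x := hx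
      have h0 : 0 < 1 + x := by linarith
      have : 1 / (1 + x) - (1 - x) = x ^ 2 / (1 + x) := by field_simp; ring
      rw [this]; positivity
  have mh : MonotoneOn (fun x : ℝ => (x - x ^ 2 / 2 + x ^ 3 / 2) - Real.log (1 + x))
      (Set.Ioi (-1 / 3 : ℝ)) := by
    apply monotoneOn_of_deriv_nonneg (convex_Ioi _)
      (fun x hx => (hh x hx).continuousAt.continuousWithinAt)
    · intro x hx
      rw [interior_Ioi] at hx
      exact (hh x hx).differentiableAt.differentiableWithinAt
    · intro x hx
      rw [interior_Ioi] at hx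
      rw [(hh x hx).deriv]
      have hx' : (-1 / 3 : ℝ) < x := hx
      have h0 : 0 < 1 + x := by linarith
      have h3 : 0 ≤ 1 + 3 * x := by linarith
      have : (1 - x + 3 * x ^ 2 / 2) - 1 / (1 + x) = x ^ 2 * (1 + 3 * x) / (2 * (1 + x)) := by
        field_simp; ring
      rw [this]; positivity
  have m0 : (0 : ℝ) ∈ Set.Ioi (-1 / 3 : ℝ) := by norm_num
  have mc : c ∈ Set.Ioi (-1 / 3 : ℝ) := h1
  constructor
  · intro h
    have e1 := mg m0 mc h
    have e2 := mh m0 mc h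
    simp at e1 e2
    constructor <;> linarith
  · intro h
    have e1 := mg mc m0 h
    have e2 := mh mc m0 h
    simp at e1 e2
    constructor <;> linarith

lemma choose_succ_aux (x : ℝ) (n : ℕ) :
    Ring.choose x (n + 1) = (x - n) / (n + 1) * Ring.choose x n := by
  have h := Ring.descPochhammer_eq_factorial_smul_choose x (n + 1)
  have h' := Ring.descPochhammer_eq_factorial_smul_choose x n
  rw [descPochhammer_succ_right, Polynomial.smeval_mul, h'] at h
  simp [Polynomial.smeval_sub, Polynomial.smeval_natCast, Nat.factorial_succ] at h
  have hn : ((n.factorial : ℕ) : ℝ) ≠ 0 := by positivity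
  have h1 : (n : ℝ) + 1 ≠ 0 := by positivity
  field_simp
  apply mul_left_cancel₀ hn
  linear_combination -h

lemma ttSeq_eq_choose (a c : ℝ) (hc : c ≠ 0) (n : ℕ) :
    ttSeq a c n = Ring.choose (a / c) n * c ^ n := by
  induction n with
  | zero => simp [ttSeq]
  | succ n ih =>
    rw [ttSeq, ih, choose_succ_aux]
    field_simp
    ring

lemma ttSeq_zero_right (a : ℝ) (n : ℕ) : ttSeq a 0 n = a ^ n / n.factorial := by
  induction n with
  | zero => simp [ttSeq]
  | succ n ih =>
    rw [ttSeq, ih, Nat.factorial_succ]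
    push_cast
    field_simp
    ring

lemma ttSeq_hasSum (a c : ℝ) (hc : |c| < 1 / 3) :
    ∃ L, 1 - c / 2 ≤ L ∧ L ≤ 1 - c / 2 + c ^ 2 / 2 ∧ HasSum (ttSeq a c) (Real.exp (a * L)) := by
  obtain ⟨h1, h2⟩ := abs_lt.mp hc
  rcases eq_or_ne c 0 with rfl | hne
  · refine ⟨1, by norm_num, by norm_num, ?_⟩
    have := NormedSpace.expSeries_div_hasSum_exp a
    rw [← Real.exp_eq_exp_ℝ] at this
    rw [mul_one]
    rw [show ttSeq a 0 = fun n : ℕ => a ^ n / (n.factorial : ℝ) from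
      funext fun n => ttSeq_zero_right a n]
    exact this
  · refine ⟨Real.log (1 + c) / c, ?_, ?_, ?_⟩
    · rcases lt_or_gt_of_ne hne with h | h
      · rw [le_div_iff_of_neg h]
        have := ((log_lower_aux c (by linarith)).2 h.le).1
        linarith
      · rw [le_div_iff₀ h]
        have := ((log_lower_aux c (by linarith)).1 h.le).1
        linarith
    · rcases lt_or_gt_of_ne hne with h | h
      · rw [div_le_iff_of_neg h]
        have := ((log_lower_aux c (by linarith)).2 h.le).2
        linarith
      · rw [div_le_iff₀ h]
        have := ((log_lower_aux c (by linarith)).1 h.le).2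
        linarith
    · have hm : c ∈ Metric.eball (0 : ℝ) 1 := by
        simp only [Metric.mem_eball, edist_zero_right]
        rw [← ofReal_norm, Real.norm_eq_abs]
        simp; linarith
      have := (Real.one_add_rpow_hasFPowerSeriesOnBall_zero (a := a / c)).hasSum hm
      simp only [zero_add, binomialSeries_apply, List.ofFn_const, List.prod_replicate,
        smul_eq_mul] at this
      rw [Real.rpow_def_of_pos (by linarith)] at this
      rw [show ttSeq a c = fun n : ℕ => Ring.choose (a / c) n * c ^ n from
        funext fun n => ttSeq_eq_choose a c hne n,
        show a * (Real.log (1 + c) / c) = Real.log (1 + c) * (a / c) by ring]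
      exact this

lemma pow_self_aux (N : ℕ) (hN : 1 ≤ N) :
    (N : ℝ) ^ N / N.factorial ≤ Real.exp 1 ^ N / 2 := by
  obtain ⟨m, rfl⟩ : ∃ m, N = m + 1 := ⟨N - 1, by omega⟩
  have h := Real.sum_le_exp_of_nonneg (x := ((m + 1 : ℕ) : ℝ)) (by positivity) (m + 2)
  rw [Finset.sum_range_succ, Finset.sum_range_succ] at h
  have h0 : 0 ≤ ∑ i ∈ Finset.range m, ((m + 1 : ℕ) : ℝ) ^ i / (i.factorial : ℝ) :=
    Finset.sum_nonneg fun i _ => by positivity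
  have he : ((m + 1 : ℕ) : ℝ) ^ m / (m.factorial : ℝ) =
      ((m + 1 : ℕ) : ℝ) ^ (m + 1) / ((m + 1).factorial : ℝ) := by
    rw [Nat.factorial_succ]; push_cast; field_simp; ring
  rw [← Real.exp_nat_mul, mul_one]
  linarith

lemma ttSeq_head_bound (N : ℕ) (a c d : ℝ) (hd : 0 < d) (ha : 0 ≤ a) (haN : a ≤ N * d)
    (hc : |c| ≤ d) (n : ℕ) (hn : n ≤ N) :
    |ttSeq a c n| ≤ (2 * N * d) ^ n / n.factorial := by
  induction n with
  | zero => simp [ttSeq]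
  | succ n ih =>
    have ih := ih (by omega)
    have hn' : (n : ℝ) ≤ N := by exact_mod_cast (by omega : n ≤ N)
    obtain ⟨h1, h2⟩ := abs_le.mp hc
    have hn0 : (0 : ℝ) ≤ n := by positivity
    have hf : |a - n * c| ≤ 2 * N * d := by
      rw [abs_le]; constructor <;> nlinarith
    rw [ttSeq, abs_mul, abs_div, abs_of_pos (by positivity : (0 : ℝ) < (n : ℝ) + 1)]
    calc _ ≤ (2 * N * d) / (n + 1) * ((2 * N * d) ^ n / n.factorial) := by gcongr
      _ = _ := by rw [Nat.factorial_succ]; push_cast; field_simp; ring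

lemma ttSeq_tail_bound (N : ℕ) (hN : 1 ≤ N) (a c d : ℝ) (hd : 0 < d) (hd3 : d < 1 / 3)
    (ha : 0 ≤ a) (haN : a ≤ N * d) (hc : |c| ≤ d) (k : ℕ) :
    |ttSeq a c (N + k)| ≤ (2 * Real.exp 1 * d) ^ N / 2 * (2 / 3) ^ k := by
  induction k with
  | zero =>
    have h := ttSeq_head_bound N a c d hd ha haN hc N le_rfl
    have h2 := pow_self_aux N hN
    calc _ ≤ (2 * N * d) ^ N / N.factorial := h
      _ = (2 * d) ^ N * ((N : ℝ) ^ N / N.factorial) := by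
        rw [show 2 * (N : ℝ) * d = (2 * d) * N by ring, mul_pow]; ring
      _ ≤ (2 * d) ^ N * (Real.exp 1 ^ N / 2) := by gcongr
      _ = _ := by rw [show 2 * Real.exp 1 * d = (2 * d) * Real.exp 1 by ring, mul_pow]; ring
  | succ k ih =>
    obtain ⟨h1, h2⟩ := abs_le.mp hc
    have hn0 : (0 : ℝ) ≤ ((N + k : ℕ) : ℝ) := by positivity
    have hNk : (N : ℝ) ≤ ((N + k : ℕ) : ℝ) := by push_cast; linarith [(Nat.cast_nonneg k : (0:ℝ) ≤ k)]
    have hf : |a - ((N + k : ℕ) : ℝ) * c| ≤ 2 / 3 * (((N + k : ℕ) : ℝ) + 1) := by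
      rw [abs_le]; constructor <;> nlinarith
    rw [← add_assoc, ttSeq, abs_mul, abs_div,
      abs_of_pos (by positivity : (0 : ℝ) < ((N + k : ℕ) : ℝ) + 1), pow_succ]
    have hq : |a - ((N + k : ℕ) : ℝ) * c| / (((N + k : ℕ) : ℝ) + 1) ≤ 2 / 3 := by
      rw [div_le_iff₀ (by positivity)]; exact hf
    calc _ ≤ 2 / 3 * ((2 * Real.exp 1 * d) ^ N / 2 * (2 / 3) ^ k) := by gcongr
      _ = _ := by ring

lemma ttSeq_tail (N : ℕ) (hN : 1 ≤ N) (a c d F : ℝ) (hd : 0 < d) (hd3 : d < 1 / 3)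
    (ha : 0 ≤ a) (haN : a ≤ N * d) (hc : |c| ≤ d) (hF : HasSum (ttSeq a c) F) :
    |F - ∑ i ∈ Finset.range (N + 1), ttSeq a c i| ≤ (2 * Real.exp 1 * d) ^ N := by
  have h1 := (hasSum_nat_add_iff' (N + 1)).mpr hF
  have hg : HasSum (fun k : ℕ => (2 * Real.exp 1 * d) ^ N / 3 * (2 / 3 : ℝ) ^ k)
      ((2 * Real.exp 1 * d) ^ N) := by
    have := (hasSum_geometric_of_lt_one (r := (2 / 3 : ℝ)) (by norm_num) (by norm_num)).mul_left
      ((2 * Real.exp 1 * d) ^ N / 3)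
    rw [show (1 - 2 / 3 : ℝ)⁻¹ = 3 by norm_num, div_mul_cancel₀ _ (by norm_num : (3 : ℝ) ≠ 0)] at this
    exact this
  rw [← Real.norm_eq_abs, ← h1.tsum_eq]
  apply tsum_of_norm_bounded hg
  intro k
  have := ttSeq_tail_bound N hN a c d hd hd3 ha haN hc (k + 1)
  rw [Real.norm_eq_abs, show k + (N + 1) = N + (k + 1) by ring]
  refine this.trans_eq ?_
  ring

/-- Alternating tail. -/
lemma ttSeq_alt (a c F : ℝ) (K : ℕ) (ha : 0 ≤ a) (hc0 : 0 < c) (hc1 : c < 1 / 3)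
    (hK : a - K * c < 0) (hpos : 0 ≤ ttSeq a c K) (hF : HasSum (ttSeq a c) F) :
    F ≤ ∑ i ∈ Finset.range (K + 1), ttSeq a c i := by
  have hr : ∀ m : ℕ, K ≤ m → -1 ≤ (a - m * c) / (m + 1) ∧ (a - m * c) / (m + 1) ≤ 0 := by
    intro m hm
    have hm' : (K : ℝ) ≤ m := by exact_mod_cast hm
    have hm0 : (0 : ℝ) ≤ m := by positivity
    constructor
    · rw [le_div_iff₀ (by positivity)]; nlinarith
    · apply div_nonpos_of_nonpos_of_nonneg _ (by positivity); nlinarith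
  have key : ∀ m : ℕ, ttSeq a c (K + 1 + 2 * m) ≤ 0 ∧
      ∑ i ∈ Finset.range (K + 1 + 2 * m), ttSeq a c i ≤
        ∑ i ∈ Finset.range (K + 1), ttSeq a c i := by
    intro m
    induction m with
    | zero =>
      refine ⟨?_, le_rfl⟩
      simp only [mul_zero, add_zero, ttSeq]
      exact mul_nonpos_of_nonpos_of_nonneg (hr K le_rfl).2 hpos
    | succ m ih =>
      obtain ⟨i1, i2⟩ := ih
      obtain ⟨r1, r2⟩ := hr (K + 1 + 2 * m) (by omega)
      obtain ⟨s1, s2⟩ := hr (K + 1 + 2 * m + 1) (by omega)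
      have e1 : ttSeq a c (K + 1 + 2 * m + 1) = _ * ttSeq a c (K + 1 + 2 * m) := rfl
      have e2 : ttSeq a c (K + 1 + 2 * m + 1 + 1) = _ * ttSeq a c (K + 1 + 2 * m + 1) := rfl
      have p1 : 0 ≤ ttSeq a c (K + 1 + 2 * m + 1) := by
        rw [e1]; exact mul_nonneg_of_nonpos_of_nonpos r2 i1
      rw [show K + 1 + 2 * (m + 1) = K + 1 + 2 * m + 1 + 1 by ring]
      constructor
      · rw [e2]; exact mul_nonpos_of_nonpos_of_nonneg s2 p1
      · rw [Finset.sum_range_succ, Finset.sum_range_succ]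
        have : ttSeq a c (K + 1 + 2 * m + 1) ≤ - ttSeq a c (K + 1 + 2 * m) := by
          rw [e1]; nlinarith
        linarith
  have ht : Filter.Tendsto (fun m : ℕ => K + 1 + 2 * m) Filter.atTop Filter.atTop :=
    Filter.tendsto_atTop_mono (fun m => by simp only [id]; omega) Filter.tendsto_id
  exact le_of_tendsto' (hF.tendsto_sum_nat.comp ht) fun m => (key m).2

/-- the summation lemma (Corollary 4.5 of Greenhill–McKay–Wang). -/
theorem summation_lemma (N : ℕ) (hN : 2 ≤ N) (A C : ℕ → ℝ) (A₁ A₂ C₁ C₂ cHat : ℝ)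
    (hApos : ∀ i, 1 ≤ i → i ≤ N → 0 ≤ A i)
    (hACpos : ∀ i, 1 ≤ i → i ≤ N → 0 ≤ A i - ((i : ℝ) - 1) * C i)
    (hA₁ : IsLeast (A '' Set.Icc 1 N) A₁)
    (hA₂ : IsGreatest (A '' Set.Icc 1 N) A₂)
    (hC₁ : IsLeast (C '' Set.Icc 1 N) C₁)
    (hC₂ : IsGreatest (C '' Set.Icc 1 N) C₂)
    (hcHat0 : 0 < cHat) (hcHat3 : cHat < 1 / 3)
    (hmax : A₂ / (N : ℝ) ≤ cHat ∧ |C₁| ≤ cHat ∧ |C₂| ≤ cHat)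
    (ns : ℕ → ℝ) (hns0 : ns 0 = 1)
    (hns : ∀ i, 1 ≤ i → i ≤ N →
      ns i = (1 / (i : ℝ)) * (A i - ((i : ℝ) - 1) * C i) * ns (i - 1)) :
    Real.exp (A₁ - A₁ * C₂ / 2) - (2 * Real.exp 1 * cHat) ^ N ≤
        ∑ i ∈ Finset.range (N + 1), ns i ∧
      ∑ i ∈ Finset.range (N + 1), ns i ≤
        Real.exp (A₂ - A₂ * C₁ / 2 + A₂ * C₁ ^ 2 / 2) + (2 * Real.exp 1 * cHat) ^ N := by
  obtain ⟨hm1, hm2, hm3⟩ := hmax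
  have hN0 : (0 : ℝ) < N := by exact_mod_cast (by omega : 0 < N)
  rw [div_le_iff₀ hN0, mul_comm] at hm1
  have bA1 : ∀ i, 1 ≤ i → i ≤ N → A₁ ≤ A i := fun i h h' => hA₁.2 ⟨i, ⟨h, h'⟩, rfl⟩
  have bA2 : ∀ i, 1 ≤ i → i ≤ N → A i ≤ A₂ := fun i h h' => hA₂.2 ⟨i, ⟨h, h'⟩, rfl⟩
  have bC1 : ∀ i, 1 ≤ i → i ≤ N → C₁ ≤ C i := fun i h h' => hC₁.2 ⟨i, ⟨h, h'⟩, rfl⟩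
  have bC2 : ∀ i, 1 ≤ i → i ≤ N → C i ≤ C₂ := fun i h h' => hC₂.2 ⟨i, ⟨h, h'⟩, rfl⟩
  have pA1 : 0 ≤ A₁ := by
    obtain ⟨i, ⟨h, h'⟩, rfl⟩ := hA₁.1
    exact hApos i h h'
  have hA12 : A₁ ≤ A₂ := (bA1 1 le_rfl (by omega)).trans (bA2 1 le_rfl (by omega))
  have pA2 : 0 ≤ A₂ := pA1.trans hA12
  -- the recursion in shifted form
  have hrec : ∀ n, n + 1 ≤ N → ns (n + 1) = (A (n + 1) - n * C (n + 1)) / (n + 1) * ns n := by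
    intro n hn
    have := hns (n + 1) (by omega) hn
    simp only [Nat.add_sub_cancel] at this
    rw [this]; push_cast; ring
  have hfac : ∀ n, n + 1 ≤ N → 0 ≤ A (n + 1) - n * C (n + 1) := by
    intro n hn
    have := hACpos (n + 1) (by omega) hn
    push_cast at this
    simpa using this
  have hnn : ∀ n, n ≤ N → 0 ≤ ns n := by
    intro n hn
    induction n with
    | zero => rw [hns0]; norm_num
    | succ n ih =>
      rw [hrec n hn]
      exact mul_nonneg (div_nonneg (hfac n hn) (by positivity)) (ih (by omega))
  constructor
  · obtain ⟨L, hL1, -, hF⟩ := ttSeq_hasSum A₁ C₂ (by linarith)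
    have hexp : Real.exp (A₁ - A₁ * C₂ / 2) ≤ Real.exp (A₁ * L) := by
      apply Real.exp_le_exp.mpr; nlinarith
    have hcmp : ∀ K, K ≤ N → (∀ j, j < K → 0 ≤ A₁ - j * C₂) →
        ∀ n, n ≤ K → 0 ≤ ttSeq A₁ C₂ n ∧ ttSeq A₁ C₂ n ≤ ns n := by
      intro K hK hj n hn
      induction n with
      | zero => rw [hns0]; simp [ttSeq]
      | succ n ih =>
        obtain ⟨i1, i2⟩ := ih (by omega)
        have f0 := hj n (by omega)
        rw [hrec n (by omega), ttSeq]
        refine ⟨mul_nonneg (div_nonneg f0 (by positivity)) i1, ?_⟩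
        have b1 := bA1 (n + 1) (by omega) (by omega)
        have b2 := bC2 (n + 1) (by omega) (by omega)
        have g0 := hfac n (by omega)
        have : A₁ - n * C₂ ≤ A (n + 1) - n * C (n + 1) := by gcongr
        gcongr
    by_cases hall : ∀ j : ℕ, j < N → 0 ≤ A₁ - j * C₂
    · have ht := ttSeq_tail N (by omega) A₁ C₂ cHat _ hcHat0 hcHat3 pA1 (by linarith) hm3 hF
      have hs : ∑ i ∈ Finset.range (N + 1), ttSeq A₁ C₂ i ≤ ∑ i ∈ Finset.range (N + 1), ns i :=
        Finset.sum_le_sum fun i hi =>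
          (hcmp N le_rfl hall i (by rw [Finset.mem_range] at hi; omega)).2
      have := (abs_le.mp ht).2
      linarith
    · push Not at hall
      have hsp := Nat.find_spec hall
      have hmin := fun m => Nat.find_min hall (m := m)
      generalize Nat.find hall = K at hsp hmin
      obtain ⟨hKN, hKneg⟩ := hsp
      have hbelow : ∀ j : ℕ, j < K → 0 ≤ A₁ - j * C₂ := by
        intro j hj
        by_contra hcon
        exact hmin j hj ⟨by omega, not_le.mp hcon⟩
      have hcK := hcmp K hKN.le hbelow
      have hKnn : (0 : ℝ) ≤ K := by positivity
      have hC2pos : 0 < C₂ := by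
        by_contra hcon
        nlinarith [mul_nonneg hKnn (sub_nonneg.mpr (not_lt.mp hcon))]
      have hC2lt : C₂ < 1 / 3 := by linarith [le_abs_self C₂]
      have h1 := ttSeq_alt A₁ C₂ _ K pA1 hC2pos hC2lt hKneg (hcK K le_rfl).1 hF
      have h2 : ∑ i ∈ Finset.range (K + 1), ttSeq A₁ C₂ i ≤ ∑ i ∈ Finset.range (K + 1), ns i :=
        Finset.sum_le_sum fun i hi => (hcK i (by rw [Finset.mem_range] at hi; omega)).2
      have h3 : ∑ i ∈ Finset.range (K + 1), ns i ≤ ∑ i ∈ Finset.range (N + 1), ns i := by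
        apply Finset.sum_le_sum_of_subset_of_nonneg
        · intro x hx; rw [Finset.mem_range] at *; omega
        · intro i hi _; exact hnn i (by rw [Finset.mem_range] at hi; omega)
      have h4 : 0 ≤ (2 * Real.exp 1 * cHat) ^ N := by positivity
      linarith
  · obtain ⟨L, -, hL2, hF⟩ := ttSeq_hasSum A₂ C₁ (by linarith)
    have hexp : Real.exp (A₂ * L) ≤ Real.exp (A₂ - A₂ * C₁ / 2 + A₂ * C₁ ^ 2 / 2) := by
      apply Real.exp_le_exp.mpr; nlinarith
    have hcmp : ∀ n, n ≤ N → ns n ≤ ttSeq A₂ C₁ n := by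
      intro n hn
      induction n with
      | zero => rw [hns0]; simp [ttSeq]
      | succ n ih =>
        have i1 := ih (by omega)
        have i0 := hnn n (by omega)
        rw [hrec n (by omega), ttSeq]
        have b1 := bA2 (n + 1) (by omega) (by omega)
        have b2 := bC1 (n + 1) (by omega) (by omega)
        have g0 := hfac n (by omega)
        have hle : A (n + 1) - n * C (n + 1) ≤ A₂ - n * C₁ := by gcongr
        have g1 : 0 ≤ A₂ - n * C₁ := g0.trans hle
        gcongr
    have ht := ttSeq_tail N (by omega) A₂ C₁ cHat _ hcHat0 hcHat3 pA2 (by linarith) hm2 hF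
    have hs : ∑ i ∈ Finset.range (N + 1), ns i ≤ ∑ i ∈ Finset.range (N + 1), ttSeq A₂ C₁ i :=
      Finset.sum_le_sum fun i hi => hcmp i (by rw [Finset.mem_range] at hi; omega)
    have := (abs_le.mp ht).1
    linarith
end

section
/- Let r ≥ 3 be fixed. There exist constants C > 0 and δ > 0 depending only on r such that for every degree sequence k with sum M divisible by r, k_max ≥ 2 and k_max^3 ≤ δM, the probability that a uniformly random Q ∈ Λ_r(k) has two distinct parts whose corresponding edges of G(Q) share at least 3 vertices is at most C·k_max^3/M. -/
open scoped Classical BigOperators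

namespace LargeInt

open Finset

variable {n : ℕ}

/-- The event that `x 0, x 1, x 2` share a part and `x 3, x 4, x 5` share a part. -/
def Ev {k : Fin n → ℕ} (Q : Finset (Finset (Pts k))) (x : Fin 6 ↪ Pts k) : Prop :=
  (∃ U ∈ Q, x 0 ∈ U ∧ x 1 ∈ U ∧ x 2 ∈ U) ∧ (∃ U ∈ Q, x 3 ∈ U ∧ x 4 ∈ U ∧ x 5 ∈ U)

lemma card_pts (k : Fin n → ℕ) : Fintype.card (Pts k) = Mtot k := by
  simp [Pts, Mtot]

/-- Transport of a partition along a permutation. -/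
noncomputable def tr {k : Fin n → ℕ} (σ : Equiv.Perm (Pts k)) (Q : Finset (Finset (Pts k))) :
    Finset (Finset (Pts k)) :=
  Q.map (Finset.mapEmbedding σ.toEmbedding).toEmbedding

lemma mem_tr {k : Fin n → ℕ} (σ : Equiv.Perm (Pts k)) (Q : Finset (Finset (Pts k)))
    (V : Finset (Pts k)) : V ∈ tr σ Q ↔ ∃ U ∈ Q, U.map σ.toEmbedding = V := by
  simp [tr]

lemma tr_inj {k : Fin n → ℕ} (σ : Equiv.Perm (Pts k)) : Function.Injective (tr σ) :=
  Finset.map_injective _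

lemma tr_part {r : ℕ} {k : Fin n → ℕ} (σ : Equiv.Perm (Pts k)) {Q : Finset (Finset (Pts k))}
    (h : IsPartition r k Q) : IsPartition r k (tr σ Q) := by
  refine ⟨?_, ?_⟩
  · intro V hV
    obtain ⟨U, hU, rfl⟩ := (mem_tr _ _ _).1 hV
    rw [card_map]
    exact h.1 U hU
  · intro p
    obtain ⟨U, ⟨hU, hp⟩, huniq⟩ := h.2 (σ.symm p)
    refine ⟨U.map σ.toEmbedding, ⟨(mem_tr _ _ _).2 ⟨U, hU, rfl⟩, ?_⟩, ?_⟩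
    · exact Finset.mem_map.2 ⟨_, hp, by simp⟩
    · rintro V ⟨hV, hpV⟩
      obtain ⟨W, hW, rfl⟩ := (mem_tr _ _ _).1 hV
      obtain ⟨q, hq, hqp⟩ := Finset.mem_map.1 hpV
      have : q = σ.symm p := by rw [← hqp]; simp
      rw [huniq W ⟨hW, this ▸ hq⟩]

lemma ev_card_le {r : ℕ} {k : Fin n → ℕ} (x y : Fin 6 ↪ Pts k) :
    #{Q ∈ LamFinset r k | Ev Q x} ≤ #{Q ∈ LamFinset r k | Ev Q y} := by
  obtain ⟨σ, hσ⟩ : ∃ σ : Equiv.Perm (Pts k), σ • x = y :=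
    (Equiv.Perm.isMultiplyPretransitive (Pts k) 6).exists_smul_eq x y
  have hx : ∀ i, y i = σ (x i) := by
    intro i; rw [← hσ]; rfl
  refine Finset.card_le_card_of_injOn (tr σ) ?_ (tr_inj σ).injOn
  intro Q hQ
  have hQ' := Finset.mem_filter.1 (Finset.mem_coe.1 hQ)
  have hP : IsPartition r k Q := (Finset.mem_filter.1 hQ'.1).2
  obtain ⟨⟨U, hU, h0, h1, h2⟩, ⟨W, hW, h3, h4, h5⟩⟩ := hQ'.2
  refine Finset.mem_coe.2 (Finset.mem_filter.2
    ⟨Finset.mem_filter.2 ⟨Finset.mem_univ _, tr_part σ hP⟩, ?_, ?_⟩)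
  · refine ⟨_, (mem_tr _ _ _).2 ⟨U, hU, rfl⟩, ?_, ?_, ?_⟩ <;> rw [hx] <;> simpa
  · refine ⟨_, (mem_tr _ _ _).2 ⟨W, hW, rfl⟩, ?_, ?_, ?_⟩ <;> rw [hx] <;> simpa

lemma ev_count {r : ℕ} {k : Fin n → ℕ} {Q : Finset (Finset (Pts k))}
    (h : IsPartition r k Q) :
    #{x : Fin 6 ↪ Pts k | Ev Q x} ≤ Mtot k ^ 2 * r ^ 4 := by
  choose g hg huniq using h.2
  let T : Finset (Σ _ : Pts k, Pts k × Pts k) := Finset.univ.sigma fun a => g a ×ˢ g a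
  have hT : #T = Mtot k * r ^ 2 := by
    have : ∀ a, #(g a) = r := fun a => h.1 _ (hg a).1
    simp only [T, Finset.card_sigma, Finset.card_product, this, Finset.sum_const,
      Finset.card_univ, card_pts]
    simp [sq]
  have : #{x : Fin 6 ↪ Pts k | Ev Q x} ≤ #(T ×ˢ T) := by
    refine Finset.card_le_card_of_injOn
      (fun x => (⟨x 0, (x 1, x 2)⟩, ⟨x 3, (x 4, x 5)⟩)) ?_ ?_
    · intro x hx
      obtain ⟨⟨U, hU, h0, h1, h2⟩, ⟨W, hW, h3, h4, h5⟩⟩ :=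
        (Finset.mem_filter.1 (Finset.mem_coe.1 hx)).2
      have e1 := huniq _ U ⟨hU, h0⟩
      have e2 := huniq _ W ⟨hW, h3⟩
      simp [T, ← e1, ← e2, h1, h2, h4, h5]
    · intro x _ y _ hxy
      simp only [Prod.mk.injEq, Sigma.mk.injEq, heq_eq_eq] at hxy
      obtain ⟨⟨a, b, c⟩, d, e, f⟩ := hxy
      ext1 i
      fin_cases i <;> assumption
  calc _ ≤ _ := this
    _ = _ := by rw [Finset.card_product, hT]; ring

/-- Tuples witnessing a large intersection. -/
noncomputable def Tup (k : Fin n → ℕ) : Finset (Fin 6 ↪ Pts k) :=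
  {x | (x 0).1 = (x 3).1 ∧ (x 1).1 = (x 4).1 ∧ (x 2).1 = (x 5).1}

lemma card_Tup (k : Fin n → ℕ) : #(Tup k) ≤ Mtot k ^ 3 * kmax k ^ 3 := by
  let P : Finset (Σ _ : Pts k, Pts k) :=
    Finset.univ.sigma fun a => (Finset.univ.filter fun b : Pts k => a.1 = b.1)
  have hP : #P ≤ Mtot k * kmax k := by
    rw [Finset.card_sigma, ← card_pts, ← Finset.card_univ, ← smul_eq_mul]
    refine Finset.sum_le_card_nsmul _ _ _ ?_
    intro a _
    have h1 : #(Finset.univ.filter fun b : Pts k => a.1 = b.1) ≤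
        #(Finset.univ : Finset (Fin (k a.1))) := by
      refine Finset.card_le_card_of_surjOn (fun j => (⟨a.1, j⟩ : Pts k)) ?_
      rintro ⟨i, j⟩ hb
      have hb' : a.1 = i := by simpa using hb
      subst hb'
      exact ⟨j, by simp, rfl⟩
    rw [Finset.card_univ, Fintype.card_fin] at h1
    exact h1.trans (Finset.le_sup (f := k) (Finset.mem_univ a.1))
  have : #(Tup k) ≤ #(P ×ˢ P ×ˢ P) := by
    refine Finset.card_le_card_of_injOn
      (fun x => (⟨x 0, x 3⟩, ⟨x 1, x 4⟩, ⟨x 2, x 5⟩)) ?_ ?_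
    · intro x hx
      have := (Finset.mem_filter.1 (Finset.mem_coe.1 hx)).2
      simp [P, this]
    · intro x _ y _ hxy
      simp only [Prod.mk.injEq, Sigma.mk.injEq, heq_eq_eq] at hxy
      obtain ⟨⟨a, b⟩, ⟨c, d⟩, e, f⟩ := hxy
      ext1 i
      fin_cases i <;> assumption
  calc _ ≤ _ := this
    _ = #P ^ 3 := by rw [Finset.card_product, Finset.card_product]; ring
    _ ≤ (Mtot k * kmax k) ^ 3 := Nat.pow_le_pow_left hP 3
    _ = _ := by ring

lemma ev_prob {r : ℕ} {k : Fin n → ℕ} (x : Fin 6 ↪ Pts k) :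
    (Mtot k).descFactorial 6 * #{Q ∈ LamFinset r k | Ev Q x} ≤
      #(LamFinset r k) * (Mtot k ^ 2 * r ^ 4) := by
  calc (Mtot k).descFactorial 6 * #{Q ∈ LamFinset r k | Ev Q x}
      = ∑ _y : Fin 6 ↪ Pts k, #{Q ∈ LamFinset r k | Ev Q x} := by
        rw [Finset.sum_const, Finset.card_univ, Fintype.card_embedding_eq, card_pts,
          Fintype.card_fin, smul_eq_mul]
    _ ≤ ∑ y : Fin 6 ↪ Pts k, #{Q ∈ LamFinset r k | Ev Q y} :=
        Finset.sum_le_sum fun y _ => ev_card_le x y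
    _ = ∑ Q ∈ LamFinset r k, #{y : Fin 6 ↪ Pts k | Ev Q y} := by
        simp only [Finset.card_filter]
        exact Finset.sum_comm
    _ ≤ #(LamFinset r k) * (Mtot k ^ 2 * r ^ 4) := by
        rw [← smul_eq_mul]
        refine Finset.sum_le_card_nsmul _ _ _ fun Q hQ => ?_
        exact ev_count (Finset.mem_filter.1 hQ).2

lemma bad_tup {r : ℕ} {k : Fin n → ℕ} {Q : Finset (Finset (Pts k))}
    (h : IsPartition r k Q) {U W : Finset (Pts k)} (hU : U ∈ Q) (hW : W ∈ Q) (hne : U ≠ W)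
    (h3 : 3 ≤ (vset U ∩ vset W).card) : ∃ x ∈ Tup k, Ev Q x := by
  have hdis : ∀ p ∈ U, ∀ q ∈ W, p ≠ q := by
    rintro p hp q hq rfl
    exact hne ((h.2 p).unique ⟨hU, hp⟩ ⟨hW, hq⟩)
  obtain ⟨a, b, c, ha, hb, hc, hab, hac, hbc⟩ := Finset.two_lt_card_iff.1 (show 2 < _ from h3)
  simp only [vset, Finset.mem_inter, Finset.mem_image] at ha hb hc
  obtain ⟨⟨p0, m0, rfl⟩, q0, l0, e0⟩ := ha
  obtain ⟨⟨p1, m1, rfl⟩, q1, l1, e1⟩ := hb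
  obtain ⟨⟨p2, m2, rfl⟩, q2, l2, e2⟩ := hc
  have key : ∀ p q : Pts k, p = q → p.1 = q.1 := fun p q h => h ▸ rfl
  have hinj : Function.Injective ![p0, p1, p2, q0, q1, q2] := by
    intro i j hij
    have n1 := hdis _ m0 _ l0
    have n2 := hdis _ m1 _ l1
    have n3 := hdis _ m2 _ l2
    fin_cases i <;> fin_cases j <;> first
      | rfl
      | (exfalso
         simp at hij
         first
          | (exact n1 hij) | (exact n2 hij) | (exact n3 hij)
          | (exact n1 hij.symm) | (exact n2 hij.symm) | (exact n3 hij.symm)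
          | (have hk := key _ _ hij
             try simp only [e0, e1, e2] at hk
             first
              | exact hab hk
              | exact hac hk
              | exact hbc hk
              | exact hab hk.symm
              | exact hac hk.symm
              | exact hbc hk.symm))
  refine ⟨⟨_, hinj⟩, ?_, ⟨U, hU, m0, m1, m2⟩, ⟨W, hW, l0, l1, l2⟩⟩
  simp only [Tup, Finset.mem_filter, Finset.mem_univ, true_and]
  exact ⟨e0.symm, e1.symm, e2.symm⟩

lemma bad_count (r : ℕ) (k : Fin n → ℕ) :
    (Mtot k).descFactorial 6 * #{Q ∈ LamFinset r k |
              ∃ U ∈ Q, ∃ W ∈ Q, U ≠ W ∧ 3 ≤ (vset U ∩ vset W).card} ≤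
      (Mtot k ^ 3 * kmax k ^ 3) * (#(LamFinset r k) * (Mtot k ^ 2 * r ^ 4)) := by
  have h1 : #{Q ∈ LamFinset r k |
              ∃ U ∈ Q, ∃ W ∈ Q, U ≠ W ∧ 3 ≤ (vset U ∩ vset W).card} ≤
      ∑ x ∈ Tup k, #{Q ∈ LamFinset r k | Ev Q x} := by
    refine le_trans (Finset.card_le_card ?_) Finset.card_biUnion_le
    intro Q hQ
    obtain ⟨hL, U, hU, W, hW, hne, h3⟩ := Finset.mem_filter.1 hQ
    obtain ⟨x, hx, hE⟩ := bad_tup (Finset.mem_filter.1 hL).2 hU hW hne h3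
    exact Finset.mem_biUnion.2 ⟨x, hx, Finset.mem_filter.2 ⟨hL, hE⟩⟩
  calc _ ≤ (Mtot k).descFactorial 6 * ∑ x ∈ Tup k, #{Q ∈ LamFinset r k | Ev Q x} :=
        Nat.mul_le_mul_left _ h1
    _ = ∑ x ∈ Tup k, (Mtot k).descFactorial 6 * #{Q ∈ LamFinset r k | Ev Q x} :=
        Finset.mul_sum _ _ _
    _ ≤ #(Tup k) * (#(LamFinset r k) * (Mtot k ^ 2 * r ^ 4)) := by
        rw [← smul_eq_mul (#(Tup k))]
        exact Finset.sum_le_card_nsmul _ _ _ fun x _ => ev_prob x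
    _ ≤ _ := Nat.mul_le_mul_right _ (card_Tup k)

end LargeInt

/-- the probability that two distinct parts yield edges sharing at
least 3 vertices is O(k_max³/M). -/
theorem probability_large_intersection (r : ℕ) (hr : 3 ≤ r) :
    ∃ C δ : ℝ, 0 < C ∧ 0 < δ ∧
      ∀ (n : ℕ) (k : Fin n → ℕ),
        r ∣ Mtot k → 2 ≤ kmax k → (kmax k : ℝ) ^ 3 ≤ δ * (Mtot k : ℝ) →
        (Set.ncard {Q ∈ Lam r k |
              ∃ U ∈ Q, ∃ W ∈ Q, U ≠ W ∧ 3 ≤ (vset U ∩ vset W).card} : ℝ) /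
            (Set.ncard (Lam r k) : ℝ) ≤ C * (kmax k : ℝ) ^ 3 / (Mtot k : ℝ) := by
  have hr0 : (0 : ℝ) < r := by
    have : 0 < r := by omega
    exact_mod_cast this
  refine ⟨64 * (r : ℝ) ^ 4, 1 / 2, by positivity, by norm_num, ?_⟩
  intro n k _ hk hM
  have hk2 : (2 : ℝ) ≤ kmax k := by exact_mod_cast hk
  have hk8 : (2 : ℝ) ^ 3 ≤ (kmax k : ℝ) ^ 3 := pow_le_pow_left₀ (by norm_num) hk2 3
  have hM16 : (16 : ℝ) ≤ Mtot k := by linarith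
  have hM16' : 16 ≤ Mtot k := by exact_mod_cast hM16
  have e1 : Lam r k = ↑(LamFinset r k) := by
    ext Q; simp [Lam, LamFinset]
  have e2 : {Q ∈ Lam r k | ∃ U ∈ Q, ∃ W ∈ Q, U ≠ W ∧ 3 ≤ (vset U ∩ vset W).card} =
      ↑((LamFinset r k).filter fun Q =>
        ∃ U ∈ Q, ∃ W ∈ Q, U ≠ W ∧ 3 ≤ (vset U ∩ vset W).card) := by
    ext Q; simp [Lam, LamFinset]
  rw [e2, e1, Set.ncard_coe_finset, Set.ncard_coe_finset]
  have hb := LargeInt.bad_count r k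
  have hd : (Mtot k - 5) ^ 6 ≤ (Mtot k).descFactorial 6 := Nat.pow_sub_le_descFactorial _ 6
  generalize Finset.card _ = b at hb ⊢
  generalize Finset.card _ = L at hb ⊢
  have hb' : ((Mtot k : ℝ) - 5) ^ 6 * b ≤
      ((Mtot k : ℝ) ^ 3 * (kmax k : ℝ) ^ 3) * (L * ((Mtot k : ℝ) ^ 2 * (r : ℝ) ^ 4)) := by
    have := (Nat.mul_le_mul_right b hd).trans hb
    have h2 : (((Mtot k - 5 : ℕ) : ℝ)) = (Mtot k : ℝ) - 5 := by
      rw [Nat.cast_sub (by omega)]; norm_num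
    rw [← h2]
    exact_mod_cast this
  set M : ℝ := (Mtot k : ℝ)
  have hM0 : 0 < M := by linarith
  have hp : (M / 2) ^ 6 ≤ (M - 5) ^ 6 := pow_le_pow_left₀ (by positivity) (by linarith) 6
  have hb2 : (M / 2) ^ 6 * b ≤
      (M ^ 3 * (kmax k : ℝ) ^ 3) * (L * (M ^ 2 * (r : ℝ) ^ 4)) :=
    (mul_le_mul_of_nonneg_right hp (Nat.cast_nonneg b)).trans hb'
  have hb3 : M * b ≤ 64 * (r : ℝ) ^ 4 * (kmax k : ℝ) ^ 3 * L := by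
    have h5 : 0 < M ^ 5 := by positivity
    refine le_of_mul_le_mul_left ?_ h5
    nlinarith [hb2]
  refine div_le_of_le_mul₀ (Nat.cast_nonneg L) (by positivity) ?_
  rw [div_mul_eq_mul_div, le_div_iff₀ hM0]
  linarith
end
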